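/- Let I ⊆ P = P(d,m) be a color-squarefree monomial ideal and set I' = I + 𝔪_1^{[2]} + ⋯ + 𝔪_d^{[2]} ⊆ P' = P(d, m+(1,…,1)). Then there is an exact sequence of ℤ^{d+|m|}-graded P'-modules 0 → G_d → ⋯ → G_1 → G_0 = P'/I' → P'/(I' + Σ_{i=1}^d x_{i,m_i+1}·𝔪_i) → 0, where G_k = ⊕_{u ∈ [Mon_cs(P)]_k} (P'/(I' : u))(−deg(u·∏_{i ∈ cSupp(u)} x_{i,m_i+1})) and the maps are induced by the maps of the corresponding exact sequence for the ideal 𝔪_1^{[2]} + ⋯ + 𝔪_d^{[2]}. Moreover, P'/(I' + Σ_{i=1}^d x_{i,m_i+1}·𝔪_i) is minimally resolved over P' by iterated mapping cones from this exact sequence. -/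

import Mathlib

open Finset
open scoped Classical

noncomputable section

namespace BalSq

variable {d : ℕ} {m : Fin d → ℕ}

/-- The set of variables `x_{i,j}` of `P(d,m)`: the variable `⟨i,j⟩` has color `i`. -/
abbrev Var (d : ℕ) (m : Fin d → ℕ) : Type := Σ i : Fin d, Fin (m i)

/-- Monomials of `P(d,m)`, encoded as exponent vectors. -/
abbrev Mon (d : ℕ) (m : Fin d → ℕ) : Type := Var d m →₀ ℕ

/-- The vertex set `V = V_1 ∪ ⋯ ∪ V_d`, where `V_i` has `m i + 1` elements;
these are also the variables of `P(d, m + (1,…,1))`. -/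
abbrev Vtx (d : ℕ) (m : Fin d → ℕ) : Type := Σ i : Fin d, Fin (m i + 1)

/-- The monomial `x_{i,j}`. -/
def xvar (i : Fin d) (j : Fin (m i)) : Mon d m := Finsupp.single ⟨i, j⟩ 1

/-- Total degree of a monomial. -/
def deg (u : Mon d m) : ℕ := u.sum fun _ n => n

/-- A monomial is color-squarefree if it is divisible by at most one variable of each color. -/
def ColorSquarefree (u : Mon d m) : Prop :=
  ∀ i : Fin d, (∑ j : Fin (m i), u ⟨i, j⟩) ≤ 1

/-- A color-squarefree monomial order ideal: a finite set of color-squarefree monomials,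
closed under divisibility, containing `1` and all the variables. -/
def IsOrderIdeal (U : Finset (Mon d m)) : Prop :=
  (∀ u ∈ U, ColorSquarefree u) ∧
  (∀ u ∈ U, ∀ v : Mon d m, v ≤ u → v ∈ U) ∧
  ((0 : Mon d m) ∈ U) ∧
  (∀ (i : Fin d) (j : Fin (m i)), xvar i j ∈ U)

/-- The strict order `≺` on variables: `x_{i,j} ≺ x_{k,ℓ}` iff `i < k`, or `i = k` and `j < ℓ`. -/
def vlt (a b : Var d m) : Prop :=
  a.1 < b.1 ∨ (a.1 = b.1 ∧ (a.2 : ℕ) < (b.2 : ℕ))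

variable (K : Type*) [Field K]

/-- The polynomial ring `P(d,m)`. -/
abbrev PR (d : ℕ) (m : Fin d → ℕ) (K : Type*) [Field K] : Type _ :=
  MvPolynomial (Var d m) K

/-- The monomial of `P(d,m)` with exponent vector `u`. -/
def mon (u : Mon d m) : PR d m K := MvPolynomial.monomial u 1

/-- The ideal `I(U)` generated by all monomials of `P(d,m)` not lying in `U`. -/
def IU (U : Finset (Mon d m)) : Ideal (PR d m K) :=
  Ideal.span { p : PR d m K | ∃ u : Mon d m, u ∉ U ∧ p = mon K u }

/-- The ideal `𝔪_1^2 + ⋯ + 𝔪_d^2` of `P(d,m)`. -/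
def sqIdeal : Ideal (PR d m K) :=
  Ideal.span { p : PR d m K | ∃ (i : Fin d) (j k : Fin (m i)),
    p = mon K (xvar i j + xvar i k) }

/-- A monomial ideal is strongly color-stable if `x_{k,ℓ}·u ∈ I` and `j < ℓ` imply
`x_{k,j}·u ∈ I`. -/
def StronglyColorStable (I : Ideal (PR d m K)) : Prop :=
  ∀ (u : Mon d m) (k : Fin d) (l j : Fin (m k)),
    mon K (xvar k l + u) ∈ I → j < l → mon K (xvar k j + u) ∈ I

/-- Strongly color-stable across colors. -/
def StronglyColorStableAcross (I : Ideal (PR d m K)) : Prop :=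
  StronglyColorStable K I ∧
  ∀ (u : Mon d m) (k : Fin d) (l : Fin (m k)) (i : Fin d) (j : Fin (m i)),
    ColorSquarefree (xvar k l + u) → mon K (xvar k l + u) ∈ I →
    vlt ⟨i, j⟩ ⟨k, l⟩ → ColorSquarefree (xvar i j + u) → mon K (xvar i j + u) ∈ I

/-- The minimal monomial generators of a monomial ideal. -/
def MinGens (I : Ideal (PR d m K)) : Set (Mon d m) :=
  { w | mon K w ∈ I ∧ ∀ v : Mon d m, v ≤ w → v ≠ w → mon K v ∉ I }

/-- The embedding of the variables of `P(d,m)` into those of `P(d, m + (1,…,1))`,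
identifying the vertex `j^{(i)}` with the variable `x_{i,j}`. -/
def emb : Var d m → Vtx d m := fun v => ⟨v.1, v.2.castSucc⟩

/-- The polynomial ring `P(d, m + (1,…,1))`. -/
abbrev Pp (d : ℕ) (m : Fin d → ℕ) (K : Type*) [Field K] : Type _ :=
  MvPolynomial (Vtx d m) K

/-- The Stanley-Reisner ideal of a simplicial complex on the vertex set `V`,
generated by the squarefree monomials corresponding to non-faces. -/
def SRIdeal (Δ : Set (Finset (Vtx d m))) : Ideal (Pp d m K) :=
  Ideal.span { p : Pp d m K | ∃ F : Finset (Vtx d m), F ∉ Δ ∧ p = ∏ v ∈ F, MvPolynomial.X v }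

/-- A finite set of variables is color-squarefree if it contains at most one variable of each
color; such sets correspond to the color-squarefree monomials of `P(d,m)`. -/
def CSFSet (A : Finset (Var d m)) : Prop :=
  ∀ v ∈ A, ∀ w ∈ A, v.1 = w.1 → v = w

/-- The color-squarefree monomial of `P(d, m + (1,…,1))` corresponding to `A`. -/
def monA (A : Finset (Var d m)) : Pp d m K :=
  MvPolynomial.monomial (∑ v ∈ A, Finsupp.single (emb v) 1) 1

/-- The ideal `𝔪_1^{[2]} + ⋯ + 𝔪_d^{[2]}` of `P(d, m + (1,…,1))`. -/
def brIdeal : Ideal (Pp d m K) :=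
  Ideal.span { p : Pp d m K | ∃ (i : Fin d) (j k : Fin (m i)), j < k ∧
    p = MvPolynomial.X (⟨i, j.castSucc⟩ : Vtx d m) * MvPolynomial.X (⟨i, k.castSucc⟩ : Vtx d m) }

/-- The ideal `Σ_{i=1}^d x_{i,m_i+1}·𝔪_i` of `P(d, m + (1,…,1))`. -/
def lastIdeal : Ideal (Pp d m K) :=
  Ideal.span { p : Pp d m K | ∃ (i : Fin d) (j : Fin (m i)),
    p = MvPolynomial.X (⟨i, Fin.last (m i)⟩ : Vtx d m) *
        MvPolynomial.X (⟨i, j.castSucc⟩ : Vtx d m) }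

/-- The degree of `u·∏_{i ∈ cSupp u} x_{i,m_i+1}`, for the color-squarefree monomial `u`
with support `A`. -/
def shiftDeg (A : Finset (Var d m)) : Vtx d m →₀ ℕ :=
  ∑ v ∈ A, (Finsupp.single (emb v) 1 +
    Finsupp.single (⟨v.1, Fin.last (m v.1)⟩ : Vtx d m) 1)

/-- The colon ideal `(I : u)`, where `u` is the color-squarefree monomial with support `A`. -/
def colonOf (I : Ideal (Pp d m K)) (A : Finset (Var d m)) : Ideal (Pp d m K) :=
  Submodule.colon (I : Submodule (Pp d m K) (Pp d m K)) (Ideal.span {monA K A})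

/-- The index set `[Mon_cs(P)]_k` of color-squarefree monomials of degree `k`, encoded by
their supports. -/
abbrev CSFk (d : ℕ) (m : Fin d → ℕ) (k : ℕ) : Type _ :=
  {A : Finset (Var d m) // CSFSet A ∧ A.card = k}

/-- The module `F_k = ⊕_{u ∈ [Mon_cs(P)]_k} P'/(I : u)`. -/
abbrev FmodC (I : Ideal (Pp d m K)) (k : ℕ) : Type _ :=
  ∀ A : CSFk d m k, Pp d m K ⧸ colonOf K I A.1

/-- A `P'`-linear map `P'/N₁ → P'/N₂` is graded of degree `0` with respect to the shifts
`s₁`, `s₂` (source shifted by `-s₁`, target by `-s₂`) iff it is induced by multiplication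
with a homogeneous polynomial of degree `s₁ - s₂`. -/
def GradedBetween (N₁ N₂ : Ideal (Pp d m K)) (s₁ s₂ : Vtx d m →₀ ℕ)
    (g : (Pp d m K ⧸ N₁) →ₗ[Pp d m K] Pp d m K ⧸ N₂) : Prop :=
  ∃ p : Pp d m K, (∀ μ : Vtx d m →₀ ℕ, MvPolynomial.coeff μ p ≠ 0 → μ + s₂ = s₁) ∧
    ∀ x : Pp d m K, g (Submodule.Quotient.mk x) = Submodule.Quotient.mk (p * x)

/-- The component of a linear map between direct sums (products). -/
def piComp {R : Type*} [CommRing R] {ι₁ ι₂ : Type*} [DecidableEq ι₁]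
    {M₁ : ι₁ → Type*} {M₂ : ι₂ → Type*}
    [∀ i, AddCommGroup (M₁ i)] [∀ i, Module R (M₁ i)]
    [∀ i, AddCommGroup (M₂ i)] [∀ i, Module R (M₂ i)]
    (f : (∀ i, M₁ i) →ₗ[R] ∀ i, M₂ i) (a : ι₁) (b : ι₂) : M₁ a →ₗ[R] M₂ b :=
  (LinearMap.proj b) ∘ₗ f ∘ₗ (LinearMap.single R M₁ a)

/-- The extension of the ideal `I ⊆ P(d,m)` to `P(d, m + (1,…,1))`, plus
`𝔪_1^{[2]} + ⋯ + 𝔪_d^{[2]}`; this is the ideal `I'`. -/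
def extBr (I : Ideal (PR d m K)) : Ideal (Pp d m K) :=
  Ideal.map (MvPolynomial.rename (emb : Var d m → Vtx d m)) I ⊔ brIdeal K

/-- The free module over `MvPolynomial σ K` with, for each degree `a : D`, exactly `β a`
generators in degree `a` (i.e. `⊕_a (MvPolynomial σ K)(-a)^{β a}`). -/
abbrev FMod (σ : Type*) (K : Type*) [Field K] {D : Type*} (β : D → ℕ) : Type _ :=
  (Σ a : D, Fin (β a)) →₀ MvPolynomial σ K

/-- `β : ℕ → D → ℕ` is the table of `D`-graded Betti numbers of `R/I`, where the grading on
`R = MvPolynomial σ K` is induced by the degree map `δ` on exponent vectors: there is a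
graded minimal free resolution `⋯ → F_1 → F_0 → R → R/I → 0` with
`F_k = ⊕_a R(-a)^{β k a}`.  Minimality means that all entries of the differentials lie in the
maximal ideal generated by the variables. -/
def IsMinFreeRes (σ : Type*) (K : Type*) [Field K] {D : Type*} [AddCommMonoid D]
    (δ : (σ →₀ ℕ) → D) (I : Ideal (MvPolynomial σ K)) (β : ℕ → D → ℕ) : Prop :=
  ∃ (dm : ∀ k : ℕ, FMod σ K (β (k + 1)) →ₗ[MvPolynomial σ K] FMod σ K (β k))
    (ε : FMod σ K (β 0) →ₗ[MvPolynomial σ K] MvPolynomial σ K),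
    (∀ (a : D) (i : Fin (β 0 a)) (μ : σ →₀ ℕ),
        MvPolynomial.coeff μ (ε (Finsupp.single ⟨a, i⟩ 1)) ≠ 0 → δ μ = a) ∧
    (∀ (k : ℕ) (a : D) (i : Fin (β (k + 1) a)) (b : D) (j : Fin (β k b)) (μ : σ →₀ ℕ),
        MvPolynomial.coeff μ ((dm k (Finsupp.single ⟨a, i⟩ 1)) ⟨b, j⟩) ≠ 0 → δ μ + b = a) ∧
    (∀ (k : ℕ) (a : D) (i : Fin (β (k + 1) a)) (b : D) (j : Fin (β k b)),
        MvPolynomial.coeff 0 ((dm k (Finsupp.single ⟨a, i⟩ 1)) ⟨b, j⟩) = 0) ∧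
    (LinearMap.range ε ⊔ (I : Submodule (MvPolynomial σ K) (MvPolynomial σ K)) = ⊤) ∧
    (LinearMap.range (dm 0)
      = Submodule.comap ε (I : Submodule (MvPolynomial σ K) (MvPolynomial σ K))) ∧
    (∀ k : ℕ, LinearMap.range (dm (k + 1)) = LinearMap.ker (dm k))

section graded
variable {σ : Type*} {F : Type*} [Field F] {X Y : Type*}

def Hg (dg : X → σ →₀ ℕ) (b : σ →₀ ℕ) (x : X →₀ MvPolynomial σ F) : Prop :=
  ∀ i μ, MvPolynomial.coeff μ (x i) ≠ 0 → μ + dg i = b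

def Gr (dX : X → σ →₀ ℕ) (dY : Y → σ →₀ ℕ)
    (L : (X →₀ MvPolynomial σ F) →ₗ[MvPolynomial σ F] (Y →₀ MvPolynomial σ F)) : Prop :=
  ∀ i, Hg dY (dX i) (L (Finsupp.single i 1))

def hc (dg : X → σ →₀ ℕ) (b : σ →₀ ℕ) :
    (X →₀ MvPolynomial σ F) →+ (X →₀ MvPolynomial σ F) where
  toFun x := Finsupp.onFinset x.support
    (fun i => if dg i ≤ b then MvPolynomial.monomial (b - dg i)
      (MvPolynomial.coeff (b - dg i) (x i)) else 0)
    (by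
      intro i hi
      rw [Finsupp.mem_support_iff]
      intro h
      simp [h] at hi)
  map_zero' := by ext; simp
  map_add' x y := by
    ext1 i
    simp only [Finsupp.onFinset_apply, Finsupp.add_apply, MvPolynomial.coeff_add, map_add]
    split_ifs <;> simp

lemma hc_apply (dg : X → σ →₀ ℕ) (b : σ →₀ ℕ) (x : X →₀ MvPolynomial σ F) (i : X) :
    hc dg b x i = if dg i ≤ b then MvPolynomial.monomial (b - dg i)
      (MvPolynomial.coeff (b - dg i) (x i)) else 0 := rfl

lemma Hg_zero (dg : X → σ →₀ ℕ) (b : σ →₀ ℕ) : Hg (F := F) dg b 0 := by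
  intro i μ h; simp at h

lemma Hg_add {dg : X → σ →₀ ℕ} {b : σ →₀ ℕ} {x y : X →₀ MvPolynomial σ F}
    (hx : Hg dg b x) (hy : Hg dg b y) : Hg dg b (x + y) := by
  intro i μ h
  by_cases h1 : MvPolynomial.coeff μ (x i) = 0
  · apply hy
    simpa [h1] using h
  · exact hx _ _ h1

lemma Hg_neg {dg : X → σ →₀ ℕ} {b : σ →₀ ℕ} {x : X →₀ MvPolynomial σ F}
    (hx : Hg dg b x) : Hg dg b (-x) := by
  intro i μ h
  exact hx _ _ (by simpa using h)

lemma Hg_sum {ι : Type*} {dg : X → σ →₀ ℕ} {b : σ →₀ ℕ} (s : Finset ι)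
    (f : ι → X →₀ MvPolynomial σ F)
    (h : ∀ i ∈ s, Hg dg b (f i)) : Hg dg b (∑ i ∈ s, f i) := by
  induction s using Finset.induction_on with
  | empty => simpa using Hg_zero dg b
  | insert a s ha ih =>
    rw [Finset.sum_insert ha]
    exact Hg_add (h a (by simp)) (ih fun i hi => h i (by simp [hi]))

lemma Hg_smul {dg : X → σ →₀ ℕ} {a b : σ →₀ ℕ} {p : MvPolynomial σ F}
    {x : X →₀ MvPolynomial σ F}
    (hp : ∀ μ, MvPolynomial.coeff μ p ≠ 0 → μ + a = b) (hx : Hg dg a x) :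
    Hg dg b (p • x) := by
  intro i μ h
  rw [Finsupp.smul_apply, smul_eq_mul, MvPolynomial.coeff_mul] at h
  obtain ⟨⟨u, v⟩, huv, hne⟩ := Finset.exists_ne_zero_of_sum_ne_zero h
  rw [Finset.HasAntidiagonal.mem_antidiagonal] at huv
  simp only at hne huv
  have h1 := hp u (left_ne_zero_of_mul hne)
  have h2 := hx i v (right_ne_zero_of_mul hne)
  rw [← huv, add_assoc, h2, h1]

lemma hc_of_Hg {dg : X → σ →₀ ℕ} {b : σ →₀ ℕ} {x : X →₀ MvPolynomial σ F}
    (hx : Hg dg b x) : hc dg b x = x := by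
  ext i μ
  rw [hc_apply]
  by_cases h : MvPolynomial.coeff μ (x i) = 0
  · rw [h]
    split_ifs with h1
    · rw [MvPolynomial.coeff_monomial]
      split_ifs with h2
      · rw [h2, h]
      · rfl
    · simp
  · have := hx i μ h
    have h2 : dg i ≤ b := by rw [← this]; exact le_add_self
    have h3 : b - dg i = μ := by rw [← this]; simp
    rw [if_pos h2, h3]; simp

lemma hc_of_Hg_ne {dg : X → σ →₀ ℕ} {a b : σ →₀ ℕ} {x : X →₀ MvPolynomial σ F}
    (hx : Hg dg a x) (hab : a ≠ b) : hc dg b x = 0 := by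
  ext i μ
  rw [hc_apply]
  split_ifs with h1
  · rw [MvPolynomial.coeff_monomial]
    split_ifs with h2
    · by_contra h
      apply hab
      rw [← hx i _ h]
      exact tsub_add_cancel_of_le h1
    · simp
  · simp

lemma Hg_hc (dg : X → σ →₀ ℕ) (b : σ →₀ ℕ) (x : X →₀ MvPolynomial σ F) :
    Hg dg b (hc dg b x) := by
  intro i μ h
  rw [hc_apply] at h
  split_ifs at h with h1
  · rw [MvPolynomial.coeff_monomial] at h
    split_ifs at h with h2
    · rw [← h2]; exact tsub_add_cancel_of_le h1
    · simp at h
  · simp at h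

lemma Hg_single (dg : X → σ →₀ ℕ) (i : X) (μ : σ →₀ ℕ) (c : F) :
    Hg dg (μ + dg i) (Finsupp.single i (MvPolynomial.monomial μ c)) := by
  intro j ν h
  rw [Finsupp.single_apply] at h
  split_ifs at h with h1
  · rw [MvPolynomial.coeff_monomial] at h
    split_ifs at h with h2
    · rw [← h1, h2]
    · simp at h
  · simp at h

lemma Hg_single_one (dg : X → σ →₀ ℕ) (i : X) :
    Hg (F := F) dg (dg i) (Finsupp.single i 1) := by
  have := Hg_single (F := F) dg i 0 1
  simpa using this

lemma Gr.map {dX : X → σ →₀ ℕ} {dY : Y → σ →₀ ℕ}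
    {L : (X →₀ MvPolynomial σ F) →ₗ[MvPolynomial σ F] (Y →₀ MvPolynomial σ F)}
    (hL : Gr dX dY L) {b : σ →₀ ℕ} {x : X →₀ MvPolynomial σ F} (hx : Hg dX b x) :
    Hg dY b (L x) := by
  have h1 : x = ∑ i ∈ x.support, x i • Finsupp.single i (1 : MvPolynomial σ F) := by
    conv_lhs => rw [← Finsupp.sum_single x]
    simp [Finsupp.sum]
  rw [h1, map_sum]
  apply Hg_sum
  intro i _
  rw [map_smul]
  exact Hg_smul (fun μ h => hx i μ h) (hL i)

lemma fs_ind {P : (X →₀ MvPolynomial σ F) → Prop} (h0 : P 0)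
    (ha : ∀ x y, P x → P y → P (x + y))
    (hs : ∀ i μ c, P (Finsupp.single i (MvPolynomial.monomial μ c))) (x) : P x := by
  induction x using Finsupp.induction_linear with
  | zero => exact h0
  | add f g hf hg => exact ha _ _ hf hg
  | single i p =>
    induction p using MvPolynomial.monomial_add_induction_on with
    | C a => exact hs i 0 a
    | monomial_add μ c f _ _ h => rw [Finsupp.single_add]; exact ha _ _ (hs _ _ _) h

lemma hc_map {dX : X → σ →₀ ℕ} {dY : Y → σ →₀ ℕ}
    {L : (X →₀ MvPolynomial σ F) →ₗ[MvPolynomial σ F] (Y →₀ MvPolynomial σ F)}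
    (hL : Gr dX dY L) (b : σ →₀ ℕ) (x : X →₀ MvPolynomial σ F) :
    hc dY b (L x) = L (hc dX b x) := by
  induction x using fs_ind with
  | h0 => simp
  | ha x y hx hy => simp [hx, hy]
  | hs i μ c =>
    have h := Hg_single dX i μ c
    by_cases hb : μ + dX i = b
    · subst hb
      rw [hc_of_Hg h, hc_of_Hg (hL.map h)]
    · rw [hc_of_Hg_ne h hb, hc_of_Hg_ne (hL.map h) hb, map_zero]

/-- Every element is a finite sum of homogeneous components. -/
lemma sum_hc (dg : X → σ →₀ ℕ) (x : X →₀ MvPolynomial σ F) :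
    ∃ s : Finset (σ →₀ ℕ), x = ∑ b ∈ s, hc dg b x := by
  suffices h : ∃ s : Finset (σ →₀ ℕ), ∀ t, s ⊆ t → x = ∑ b ∈ t, hc dg b x by
    obtain ⟨s, hs⟩ := h
    exact ⟨s, hs s (le_refl _)⟩
  induction x using fs_ind with
  | h0 => exact ⟨∅, by simp⟩
  | ha x y hx hy =>
    obtain ⟨s, hs⟩ := hx
    obtain ⟨t, ht⟩ := hy
    refine ⟨s ∪ t, fun r hr => ?_⟩
    simp only [map_add, Finset.sum_add_distrib]
    rw [← hs r (Finset.union_subset_left hr), ← ht r (Finset.union_subset_right hr)]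
  | hs i μ c =>
    refine ⟨{μ + dg i}, fun t ht => ?_⟩
    have h := Hg_single dg i μ c
    rw [Finset.sum_eq_single (μ + dg i)]
    · rw [hc_of_Hg h]
    · intro b _ hb
      exact hc_of_Hg_ne h hb.symm
    · intro h1; exact absurd (ht (by simp)) h1

/-- Monomial ideals, through the exponents they contain. -/
def IsMI (J : Ideal (MvPolynomial σ F)) (Q : (σ →₀ ℕ) → Prop) : Prop :=
  ∀ f, f ∈ J ↔ ∀ w, MvPolynomial.coeff w f ≠ 0 → Q w

lemma IsMI.monomial {J : Ideal (MvPolynomial σ F)} {Q : (σ →₀ ℕ) → Prop} (h : IsMI J Q)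
    {w : σ →₀ ℕ} (hw : Q w) (c : F) : MvPolynomial.monomial w c ∈ J := by
  rw [h]
  intro v hv
  rw [MvPolynomial.coeff_monomial] at hv
  split_ifs at hv with h1
  · rwa [← h1]
  · simp at hv

lemma IsMI_span (S : Set (σ →₀ ℕ)) :
    IsMI (F := F) (Ideal.span ((fun s => MvPolynomial.monomial s (1 : F)) '' S))
      (fun w => ∃ s ∈ S, s ≤ w) := by
  intro f
  rw [MvPolynomial.mem_ideal_span_monomial_image]
  simp [MvPolynomial.mem_support_iff]

lemma IsMI.sup {J J' : Ideal (MvPolynomial σ F)} {Q Q' : (σ →₀ ℕ) → Prop} (h : IsMI J Q)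
    (h' : IsMI J' Q') : IsMI (J ⊔ J') (fun w => Q w ∨ Q' w) := by
  intro f
  constructor
  · intro hf w hw
    obtain ⟨a, ha, b, hb, rfl⟩ := Submodule.mem_sup.1 hf
    by_cases h1 : MvPolynomial.coeff w a = 0
    · right; apply (h' b).1 hb; simpa [h1] using hw
    · left; exact (h a).1 ha w h1
  · intro hf
    rw [MvPolynomial.as_sum f]
    apply Ideal.sum_mem
    intro w hw
    rcases hf w (by simpa [MvPolynomial.mem_support_iff] using hw) with h1 | h1
    · exact Ideal.mem_sup_left (h.monomial h1 _)
    · exact Ideal.mem_sup_right (h'.monomial h1 _)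

lemma IsMI.congr {J : Ideal (MvPolynomial σ F)} {Q Q' : (σ →₀ ℕ) → Prop} (h : IsMI J Q)
    (hq : ∀ w, Q w ↔ Q' w) : IsMI J Q' := by
  intro f
  rw [h f]
  simp only [hq]

lemma IsMI.ext {J J' : Ideal (MvPolynomial σ F)} {Q : (σ →₀ ℕ) → Prop} (h : IsMI J Q)
    (h' : IsMI J' Q) : J = J' := by
  ext f
  rw [h f, h' f]

end graded

section res
variable {σ : Type} {F : Type*} [Field F]

structure IsR (J : Ideal (MvPolynomial σ F)) {X : ℕ → Type} (dg : ∀ k, X k → σ →₀ ℕ)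
    (dm : ∀ k, (X (k + 1) →₀ MvPolynomial σ F) →ₗ[MvPolynomial σ F] (X k →₀ MvPolynomial σ F))
    (ε : (X 0 →₀ MvPolynomial σ F) →ₗ[MvPolynomial σ F] MvPolynomial σ F) : Prop where
  ge : ∀ i μ, MvPolynomial.coeff μ (ε (Finsupp.single i 1)) ≠ 0 → μ = dg 0 i
  gd : ∀ k, Gr (dg (k + 1)) (dg k) (dm k)
  mn : ∀ k i j, MvPolynomial.coeff 0 (dm k (Finsupp.single i 1) j) = 0
  se : ∃ x, 1 - ε x ∈ J
  e0 : ∀ x, x ∈ LinearMap.range (dm 0) ↔ ε x ∈ J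
  ex : ∀ k, LinearMap.range (dm (k + 1)) = LinearMap.ker (dm k)

structure IsE {ι : Type} (Jf : ι → Ideal (MvPolynomial σ F)) (s : ι → σ →₀ ℕ)
    {X : ℕ → Type} (dg : ∀ k, X k → σ →₀ ℕ)
    (dm : ∀ k, (X (k + 1) →₀ MvPolynomial σ F) →ₗ[MvPolynomial σ F] (X k →₀ MvPolynomial σ F))
    (ε : (X 0 →₀ MvPolynomial σ F) →ₗ[MvPolynomial σ F] (ι → MvPolynomial σ F)) : Prop where
  ge : ∀ i j μ, MvPolynomial.coeff μ (ε (Finsupp.single i 1) j) ≠ 0 → μ + s j = dg 0 i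
  gd : ∀ k, Gr (dg (k + 1)) (dg k) (dm k)
  mn : ∀ k i j, MvPolynomial.coeff 0 (dm k (Finsupp.single i 1) j) = 0
  se : ∀ r : ι → MvPolynomial σ F, ∃ x, ∀ j, r j - ε x j ∈ Jf j
  e0 : ∀ x, x ∈ LinearMap.range (dm 0) ↔ ∀ j, ε x j ∈ Jf j
  ex : ∀ k, LinearMap.range (dm (k + 1)) = LinearMap.ker (dm k)

/-- The free module map sending basis vectors to prescribed homogeneous elements. -/
lemma lc_Gr {X Y : Type} {dX : X → σ →₀ ℕ} {dY : Y → σ →₀ ℕ}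
    (z : X → (Y →₀ MvPolynomial σ F)) (hz : ∀ i, Hg dY (dX i) (z i)) :
    Gr dX dY (Finsupp.linearCombination (MvPolynomial σ F) z) := by
  intro i
  simpa using hz i

lemma exists_lift_zero {J : Ideal (MvPolynomial σ F)} {Q : (σ →₀ ℕ) → Prop} (hQ : IsMI J Q)
    {X : ℕ → Type} {dg : ∀ k, X k → σ →₀ ℕ} {dm ε} (h : IsR J dg dm ε)
    (b : σ →₀ ℕ) (p : MvPolynomial σ F) (hp : ∀ μ, MvPolynomial.coeff μ p ≠ 0 → μ = b) :
    ∃ z, Hg (dg 0) b z ∧ ε z - p ∈ J := by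
  obtain ⟨x, hx⟩ := h.se
  refine ⟨hc (dg 0) b (p • x), Hg_hc _ _ _, ?_⟩
  let L : (X 0 →₀ MvPolynomial σ F) →ₗ[MvPolynomial σ F] (Unit →₀ MvPolynomial σ F) :=
    Finsupp.lsingle () ∘ₗ ε
  have hL : Gr (dg 0) (fun _ : Unit => 0) L := by
    intro i u μ hμ
    simp only [L, LinearMap.comp_apply, Finsupp.lsingle_apply, Finsupp.single_eq_same] at hμ
    simpa using h.ge i μ hμ
  have h1 := hc_map hL b (p • x)
  have h2 := DFunLike.congr_fun h1 ()
  simp only [L, LinearMap.comp_apply, Finsupp.lsingle_apply, Finsupp.single_eq_same] at h2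
  rw [← h2, hc_apply, if_pos (by simp)]
  have h3 : p = MvPolynomial.monomial b (MvPolynomial.coeff b p) := by
    ext μ
    rw [MvPolynomial.coeff_monomial]
    split_ifs with hh
    · rw [hh]
    · by_contra hne
      exact hh (hp μ hne).symm
  have h4 : p - ε (p • x) ∈ J := by
    have := J.mul_mem_left p hx
    rw [mul_sub, mul_one] at this
    simpa using this
  rw [← neg_mem_iff, neg_sub]
  have h5 : p - MvPolynomial.monomial b (MvPolynomial.coeff b (ε (p • x))) =
      MvPolynomial.monomial b (MvPolynomial.coeff b p - MvPolynomial.coeff b (ε (p • x))) := by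
    rw [map_sub, ← h3]
  simp only [Finsupp.single_eq_same, tsub_zero]
  rw [h5]
  by_cases hc0 : MvPolynomial.coeff b p - MvPolynomial.coeff b (ε (p • x)) = 0
  · rw [hc0]; simp
  · apply hQ.monomial
    apply (hQ _).1 h4
    simpa using hc0

/-- Splitting a free module along a decomposition of its basis. -/
def sumE (F : Type*) [Field F] {Z A B : Type} (e : Z ≃ A ⊕ B) :
    (Z →₀ MvPolynomial σ F) ≃ₗ[MvPolynomial σ F]
    (A →₀ MvPolynomial σ F) × (B →₀ MvPolynomial σ F) :=
  (Finsupp.domLCongr e).trans (Finsupp.sumFinsuppLEquivProdFinsupp (MvPolynomial σ F))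

lemma sumE_fst {Z A B : Type} (e : Z ≃ A ⊕ B) (x : Z →₀ MvPolynomial σ F) (a : A) :
    (sumE (σ := σ) F e x).1 a = x (e.symm (Sum.inl a)) := by
  simp [sumE, Finsupp.fst_sumFinsuppLEquivProdFinsupp]

lemma sumE_snd {Z A B : Type} (e : Z ≃ A ⊕ B) (x : Z →₀ MvPolynomial σ F) (a : B) :
    (sumE (σ := σ) F e x).2 a = x (e.symm (Sum.inr a)) := by
  simp [sumE, Finsupp.snd_sumFinsuppLEquivProdFinsupp]

lemma sumE_inl {Z A B : Type} (e : Z ≃ A ⊕ B) (a : A) :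
    sumE (σ := σ) F e (Finsupp.single (e.symm (Sum.inl a)) 1) = (Finsupp.single a 1, 0) := by
  ext c : 2
  · rw [sumE_fst]; simp [Finsupp.single_apply]
  · rw [sumE_snd]; simp [Finsupp.single_apply]

lemma sumE_inr {Z A B : Type} (e : Z ≃ A ⊕ B) (a : B) :
    sumE (σ := σ) F e (Finsupp.single (e.symm (Sum.inr a)) 1) = (0, Finsupp.single a 1) := by
  ext c : 2
  · rw [sumE_fst]; simp [Finsupp.single_apply]
  · rw [sumE_snd]; simp [Finsupp.single_apply]

theorem cone_res {J : Ideal (MvPolynomial σ F)} {Q : (σ →₀ ℕ) → Prop} (hQ : IsMI J Q)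
    {X : ℕ → Type} {dg : ∀ k, X k → σ →₀ ℕ} {dX ε} (h : IsR J dg dX ε)
    {ι : Type} [Fintype ι] {Jf : ι → Ideal (MvPolynomial σ F)} {s : ι → σ →₀ ℕ}
    {Y : ℕ → Type} {dgY : ∀ k, Y k → σ →₀ ℕ} {dY εY} (hY : IsE Jf s dgY dY εY)
    (hcol : ∀ j, ∀ r ∈ Jf j, r * MvPolynomial.monomial (s j) 1 ∈ J)
    (hind : ∀ r : ι → MvPolynomial σ F, ∑ j, r j * MvPolynomial.monomial (s j) 1 ∈ J →
      ∀ j, r j ∈ Jf j)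
    (hdeg : ∀ k x y, dg k x ≠ dgY k y)
    {Z : ℕ → Type} {dgZ : ∀ k, Z k → σ →₀ ℕ} (e0 : Z 0 ≃ X 0)
    (he0 : ∀ x, dgZ 0 (e0.symm x) = dg 0 x)
    (eS : ∀ k, Z (k + 1) ≃ X (k + 1) ⊕ Y k)
    (hel : ∀ k x, dgZ (k + 1) ((eS k).symm (Sum.inl x)) = dg (k + 1) x)
    (her : ∀ k x, dgZ (k + 1) ((eS k).symm (Sum.inr x)) = dgY k x) :
    ∃ dm ε', IsR (J ⊔ Ideal.span (Set.range fun j => MvPolynomial.monomial (s j) (1 : F)))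
      dgZ dm ε' := by
  set R := MvPolynomial σ F with hR
  let θ : (Y 0 →₀ R) →ₗ[R] R :=
    (∑ j, (MvPolynomial.monomial (s j) (1 : F)) • LinearMap.proj j) ∘ₗ εY
  have hθ : ∀ x, θ x = ∑ j, εY x j * MvPolynomial.monomial (s j) (1 : F) := by
    intro x
    simp [θ, mul_comm]
  -- the lift in degree zero
  have l0 : ∀ y : Y 0, ∃ z, Hg (dg 0) (dgY 0 y) z ∧ ε z - θ (Finsupp.single y 1) ∈ J := by
    intro y
    apply exists_lift_zero hQ h
    intro μ hμ
    rw [hθ, MvPolynomial.coeff_sum] at hμ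
    obtain ⟨j, _, hj⟩ := Finset.exists_ne_zero_of_sum_ne_zero hμ
    rw [MvPolynomial.coeff_mul_monomial'] at hj
    split_ifs at hj with hle
    · rw [mul_one] at hj
      rw [← hY.ge y j _ hj, tsub_add_cancel_of_le hle]
    · simp at hj
  choose z0 hz0 hz0' using l0
  let φ0 := Finsupp.linearCombination R z0
  have hφ0 : ∀ e, ε (φ0 e) - θ e ∈ J := by
    intro e
    induction e using Finsupp.induction_linear with
    | zero => simp
    | add f g hf hg =>
      have := J.add_mem hf hg
      simp only [map_add]
      convert this using 1; ring
    | single y p =>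
      have := J.mul_mem_left p (hz0' y)
      have e1 : Finsupp.single y p = p • Finsupp.single y (1 : R) := by simp
      rw [e1]
      simp only [map_smul, smul_eq_mul]
      rw [← mul_sub]
      simpa [φ0] using this
  have hP0 : ∀ e, φ0 (dY 0 e) ∈ LinearMap.range (dX 0) := by
    intro e
    rw [h.e0]
    have h1 := hφ0 (dY 0 e)
    have h2 : θ (dY 0 e) ∈ J := by
      rw [hθ]
      apply Ideal.sum_mem
      intro j _
      exact hcol j _ ((hY.e0 _).1 ⟨e, rfl⟩ j)
    simpa using J.add_mem h1 h2
  have ddX : ∀ k x, dX k (dX (k + 1) x) = 0 := fun k x => by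
    rw [← LinearMap.mem_ker, ← h.ex]; exact ⟨x, rfl⟩
  have ddY : ∀ k x, dY k (dY (k + 1) x) = 0 := fun k x => by
    rw [← LinearMap.mem_ker, ← hY.ex]; exact ⟨x, rfl⟩
  have step : ∀ k (φ : {φ : (Y k →₀ R) →ₗ[R] (X k →₀ R) //
      Gr (dgY k) (dg k) φ ∧ ∀ e, φ (dY k e) ∈ LinearMap.range (dX k)}),
      ∃ φ' : {φ : (Y (k + 1) →₀ R) →ₗ[R] (X (k + 1) →₀ R) //
        Gr (dgY (k + 1)) (dg (k + 1)) φ ∧ ∀ e, φ (dY (k + 1) e) ∈ LinearMap.range (dX (k + 1))},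
        ∀ e, dX k (φ'.1 e) = φ.1 (dY k e) := by
    rintro k ⟨φ, hφ, hr⟩
    have : ∀ y : Y (k + 1), ∃ z, Hg (dg (k + 1)) (dgY (k + 1) y) z ∧
        dX k z = φ (dY k (Finsupp.single y 1)) := by
      intro y
      obtain ⟨z, hz⟩ := hr (Finsupp.single y 1)
      refine ⟨hc (dg (k + 1)) (dgY (k + 1) y) z, Hg_hc _ _ _, ?_⟩
      rw [← hc_map (h.gd k), hz]
      exact hc_of_Hg (hφ.map (hY.gd k y))
    choose z hz hz' using this
    have hcomm : ∀ e, dX k (Finsupp.linearCombination R z e) = φ (dY k e) := by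
      intro e
      have : dX k ∘ₗ Finsupp.linearCombination R z = φ ∘ₗ dY k := by
        apply Finsupp.lhom_ext'
        intro y
        apply LinearMap.ext_ring
        simpa using hz' y
      exact LinearMap.congr_fun this e
    refine ⟨⟨Finsupp.linearCombination R z, lc_Gr z hz, fun e => ?_⟩, hcomm⟩
    rw [h.ex, LinearMap.mem_ker, hcomm, ddY, map_zero]
  choose nxt hn using step
  let Φ : ∀ k, {φ : (Y k →₀ R) →ₗ[R] (X k →₀ R) //
      Gr (dgY k) (dg k) φ ∧ ∀ e, φ (dY k e) ∈ LinearMap.range (dX k)} :=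
    fun k => Nat.rec ⟨φ0, lc_Gr z0 hz0, hP0⟩ nxt k
  have hcomm : ∀ k e, dX k ((Φ (k + 1)).1 e) = (Φ k).1 (dY k e) := fun k e => hn k (Φ k) e
  have hΦ0 : (Φ 0).1 = φ0 := rfl
  have hmin : ∀ k (y : Y k) x, MvPolynomial.coeff 0 ((Φ k).1 (Finsupp.single y 1) x) = 0 := by
    intro k y x
    by_contra hne
    have := (Φ k).2.1 y x 0 hne
    rw [zero_add] at this
    exact hdeg k x y this
  clear_value Φ
  generalize hφ : (fun k => (Φ k).1) = φ at *
  have hφ' : ∀ k, (Φ k).1 = φ k := fun k => by rw [← hφ]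
  simp only [hφ'] at hcomm hΦ0 hmin
  have hg : ∀ k, Gr (dgY k) (dg k) (φ k) := fun k => by rw [← hφ']; exact (Φ k).2.1
  let T0 : (Z 0 →₀ R) ≃ₗ[R] (X 0 →₀ R) := Finsupp.domLCongr e0
  have hT0 : ∀ x a, T0 x a = x (e0.symm a) := fun x a => by simp [T0]
  have hT0s : ∀ a, T0 (Finsupp.single (e0.symm a) 1) = Finsupp.single a 1 := fun a => by
    simp [T0]
  let T : ∀ k, (Z (k + 1) →₀ R) ≃ₗ[R] (X (k + 1) →₀ R) × (Y k →₀ R) := fun k => sumE F (eS k)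
  have T1 : ∀ k x a, (T k x).1 a = x ((eS k).symm (Sum.inl a)) := fun k x a => sumE_fst _ _ _
  have T2 : ∀ k x a, (T k x).2 a = x ((eS k).symm (Sum.inr a)) := fun k x a => sumE_snd _ _ _
  have Tl : ∀ k a, T k (Finsupp.single ((eS k).symm (Sum.inl a)) 1) = (Finsupp.single a 1, 0) :=
    fun k a => sumE_inl _ _
  have Tr : ∀ k a, T k (Finsupp.single ((eS k).symm (Sum.inr a)) 1) = (0, Finsupp.single a 1) :=
    fun k a => sumE_inr _ _
  clear_value T T0
  obtain ⟨dm, hd0, hdS⟩ : ∃ dm : ∀ k, (Z (k + 1) →₀ R) →ₗ[R] (Z k →₀ R),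
      (∀ w, T0 (dm 0 w) = dX 0 (T 0 w).1 + φ 0 (T 0 w).2) ∧
      (∀ k w, T k (dm (k + 1) w) =
        (dX (k + 1) (T (k + 1) w).1 + φ (k + 1) (T (k + 1) w).2, - dY k (T (k + 1) w).2)) := by
    refine ⟨fun k => Nat.rec (T0.symm.toLinearMap ∘ₗ LinearMap.coprod (dX 0) (φ 0) ∘ₗ
      (T 0).toLinearMap) (fun k _ => (T k).symm.toLinearMap ∘ₗ
      (LinearMap.prod (LinearMap.coprod (dX (k + 1)) (φ (k + 1)))
        (-(dY k ∘ₗ LinearMap.snd _ _ _))) ∘ₗ (T (k + 1)).toLinearMap) k, ?_, ?_⟩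
    · intro w; simp
    · intro k w; simp
  have hl : ∀ k a x, dm (k + 1) (Finsupp.single ((eS (k+1)).symm (Sum.inl a)) 1)
      ((eS k).symm (Sum.inl x)) = dX (k + 1) (Finsupp.single a 1) x := by
    intro k a x; rw [← T1, hdS, Tl]; simp
  have hl' : ∀ k a x, dm (k + 1) (Finsupp.single ((eS (k+1)).symm (Sum.inl a)) 1)
      ((eS k).symm (Sum.inr x)) = 0 := by
    intro k a x; rw [← T2, hdS, Tl]; simp
  have hr : ∀ k a x, dm (k + 1) (Finsupp.single ((eS (k+1)).symm (Sum.inr a)) 1)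
      ((eS k).symm (Sum.inl x)) = φ (k + 1) (Finsupp.single a 1) x := by
    intro k a x; rw [← T1, hdS, Tr]; simp
  have hr' : ∀ k a x, dm (k + 1) (Finsupp.single ((eS (k+1)).symm (Sum.inr a)) 1)
      ((eS k).symm (Sum.inr x)) = - dY k (Finsupp.single a 1) x := by
    intro k a x; rw [← T2, hdS, Tr]; simp
  have h0l : ∀ a x, dm 0 (Finsupp.single ((eS 0).symm (Sum.inl a)) 1)
      (e0.symm x) = dX 0 (Finsupp.single a 1) x := by
    intro a x; rw [← hT0, hd0, Tl]; simp
  have h0r : ∀ a x, dm 0 (Finsupp.single ((eS 0).symm (Sum.inr a)) 1)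
      (e0.symm x) = φ 0 (Finsupp.single a 1) x := by
    intro a x; rw [← hT0, hd0, Tr]; simp
  refine ⟨dm, ε ∘ₗ T0.toLinearMap, ?_, ?_, ?_, ?_, ?_, ?_⟩
  · intro i μ hμ
    obtain ⟨i, rfl⟩ := e0.symm.surjective i
    rw [he0]
    apply h.ge
    rw [LinearMap.comp_apply] at hμ
    rwa [← hT0s]
  · rintro (_ | k) i j μ hμ
    · obtain ⟨j, rfl⟩ := e0.symm.surjective j
      obtain ⟨i | i, rfl⟩ := (eS 0).symm.surjective i
      · rw [he0, hel]; rw [h0l] at hμ; exact h.gd 0 i j μ hμ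
      · rw [he0, her]; rw [h0r] at hμ; exact hg 0 i j μ hμ
    · obtain ⟨j | j, rfl⟩ := (eS k).symm.surjective j <;>
      obtain ⟨i | i, rfl⟩ := (eS (k + 1)).symm.surjective i
      · rw [hel, hel]; rw [hl] at hμ; exact h.gd _ i j μ hμ
      · rw [hel, her]; rw [hr] at hμ; exact hg _ i j μ hμ
      · rw [hl'] at hμ; simp at hμ
      · rw [her, her]; rw [hr'] at hμ; exact hY.gd _ i j μ (by simpa using hμ)
  · rintro (_ | k) i j
    · obtain ⟨j, rfl⟩ := e0.symm.surjective j
      obtain ⟨i | i, rfl⟩ := (eS 0).symm.surjective i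
      · rw [h0l]; exact h.mn _ _ _
      · rw [h0r]; exact hmin _ _ _
    · obtain ⟨j | j, rfl⟩ := (eS k).symm.surjective j <;>
      obtain ⟨i | i, rfl⟩ := (eS (k + 1)).symm.surjective i
      · rw [hl]; exact h.mn _ _ _
      · rw [hr]; exact hmin _ _ _
      · rw [hl']; simp
      · rw [hr', MvPolynomial.coeff_neg, hY.mn, neg_zero]
  · obtain ⟨x, hx⟩ := h.se
    exact ⟨T0.symm x, Ideal.mem_sup_left (by simpa using hx)⟩
  · intro x
    constructor
    · rintro ⟨w, rfl⟩
      rw [LinearMap.comp_apply, LinearEquiv.coe_coe, hd0, map_add]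
      apply Ideal.add_mem
      · exact Ideal.mem_sup_left ((h.e0 _).1 ⟨_, rfl⟩)
      · set b := (T 0 w).2
        have h1 := hφ0 b
        rw [← hΦ0] at h1
        have h2 : θ b ∈ Ideal.span (Set.range fun j => MvPolynomial.monomial (s j) (1 : F)) := by
          rw [hθ]
          apply Ideal.sum_mem
          intro j _
          exact Ideal.mul_mem_left _ _ (Ideal.subset_span ⟨j, rfl⟩)
        have := Ideal.add_mem _ (Ideal.mem_sup_left h1) (Ideal.mem_sup_right h2)
        simpa using this
    · intro hx
      obtain ⟨a, ha, b, hb, hab⟩ := Submodule.mem_sup.1 hx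
      rw [LinearMap.comp_apply, LinearEquiv.coe_coe] at hab
      obtain ⟨r, hr⟩ := (Ideal.mem_span_range_iff_exists_fun).1 hb
      obtain ⟨e, he⟩ := hY.se r
      have h1 := hφ0 e
      rw [← hΦ0] at h1
      have h2 : b - θ e ∈ J := by
        rw [← hr, hθ, ← Finset.sum_sub_distrib]
        apply Ideal.sum_mem
        intro j _
        rw [← sub_mul]
        exact hcol j _ (he j)
      have h3 : ε (T0 x - φ 0 e) ∈ J := by
        rw [map_sub, ← hab]
        have := J.sub_mem (J.add_mem ha h2) h1
        convert this using 1; ring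
      obtain ⟨y, hy⟩ := (h.e0 _).2 h3
      refine ⟨(T 0).symm (y, e), ?_⟩
      apply T0.injective
      rw [hd0]
      simp [hy]
  · rintro (_ | k)
    · ext w
      constructor
      · rintro ⟨w', rfl⟩
        rw [LinearMap.mem_ker]
        apply T0.injective
        rw [hd0, hdS]
        simp [ddX, hcomm]
      · intro hw
        rw [LinearMap.mem_ker] at hw
        have hw := congrArg T0 hw
        rw [hd0, map_zero] at hw
        obtain ⟨⟨a, b⟩, rfl⟩ := (T 0).symm.surjective w
        simp only [LinearEquiv.apply_symm_apply] at hw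
        have h1 := hφ0 b
        rw [← hΦ0] at h1
        have h2 : ε (φ 0 b) ∈ J := by
          rw [← h.e0]
          refine ⟨-a, ?_⟩
          rw [map_neg]
          exact neg_eq_of_add_eq_zero_right hw
        have h3 : θ b ∈ J := by simpa using J.sub_mem h2 h1
        rw [hθ] at h3
        obtain ⟨e', he'⟩ := (hY.e0 b).2 (hind _ h3)
        have h4 : a + φ 1 e' ∈ LinearMap.range (dX 1) := by
          rw [h.ex, LinearMap.mem_ker, map_add, hcomm, he', hw]
        obtain ⟨y, hy⟩ := h4
        refine ⟨(T 1).symm (y, -e'), ?_⟩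
        apply (T 0).injective
        rw [hdS]
        simp [hy, he']
    · ext w
      constructor
      · rintro ⟨w', rfl⟩
        rw [LinearMap.mem_ker]
        apply (T k).injective
        rw [hdS, hdS]
        simp [ddX, ddY, hcomm]
      · intro hw
        rw [LinearMap.mem_ker] at hw
        have hw := congrArg (T k) hw
        rw [hdS, map_zero] at hw
        obtain ⟨⟨a, b⟩, rfl⟩ := (T (k + 1)).symm.surjective w
        simp only [LinearEquiv.apply_symm_apply, Prod.mk_eq_zero, neg_eq_zero] at hw
        obtain ⟨hw3, hw4⟩ := hw
        have h5 : b ∈ LinearMap.range (dY (k + 1)) := by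
          rw [hY.ex, LinearMap.mem_ker, hw4]
        obtain ⟨e', he'⟩ := h5
        have h4 : a + φ (k + 2) e' ∈ LinearMap.range (dX (k + 2)) := by
          rw [h.ex, LinearMap.mem_ker, map_add, hcomm, he', hw3]
        obtain ⟨y, hy⟩ := h4
        refine ⟨(T (k + 2)).symm (y, -e'), ?_⟩
        apply (T (k + 1)).injective
        rw [hdS]
        simp [hy, he']

end res

section res2
variable {σ : Type} {F : Type*} [Field F]

lemma sigS_single {ι : Type} [Fintype ι] {X : ι → Type} (j : ι) (i : X j) :
    Finsupp.sigmaFinsuppLEquivPiFinsupp (MvPolynomial σ F) (ιs := X)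
      (Finsupp.single ⟨j, i⟩ (1 : MvPolynomial σ F)) = Pi.single j (Finsupp.single i 1) := by
  funext j'
  ext i' : 1
  rw [Finsupp.sigmaFinsuppLEquivPiFinsupp_apply]
  by_cases h : j' = j
  · subst h
    simp [Finsupp.single_apply]
  · rw [Pi.single_eq_of_ne h, Finsupp.single_apply, if_neg]
    · rfl
    · intro h'
      exact h (congrArg Sigma.fst h').symm

theorem sumRes {ι : Type} [Fintype ι] {Jf : ι → Ideal (MvPolynomial σ F)} (s : ι → σ →₀ ℕ)
    {X : ι → ℕ → Type} {dg : ∀ j k, X j k → σ →₀ ℕ}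
    (h : ∀ j, ∃ dm ε, IsR (Jf j) (dg j) dm ε) :
    ∃ dm ε, IsE Jf s (X := fun k => Σ j, X j k) (fun k x => dg x.1 k x.2 + s x.1) dm ε := by
  choose dm ε h using h
  set R := MvPolynomial σ F with hR
  let S : ∀ k, ((Σ j, X j k) →₀ R) ≃ₗ[R] ∀ j, X j k →₀ R := fun k =>
    Finsupp.sigmaFinsuppLEquivPiFinsupp R (ιs := fun j => X j k)
  have hS : ∀ k x j i, S k x j i = x ⟨j, i⟩ := fun k x j i => rfl
  have hSs : ∀ k j i, S k (Finsupp.single ⟨j, i⟩ 1) = Pi.single j (Finsupp.single i 1) :=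
    fun k j i => sigS_single (X := fun j => X j k) j i
  clear_value S
  obtain ⟨D, hD⟩ : ∃ D : ∀ k, ((Σ j, X j (k + 1)) →₀ R) →ₗ[R] ((Σ j, X j k) →₀ R),
      ∀ k x j, S k (D k x) j = dm j k (S (k + 1) x j) :=
    ⟨fun k => (S k).symm.toLinearMap ∘ₗ (LinearMap.pi fun j => dm j k ∘ₗ LinearMap.proj j) ∘ₗ
      (S (k + 1)).toLinearMap, fun k x j => by simp⟩
  obtain ⟨E, hE⟩ : ∃ E : ((Σ j, X j 0) →₀ R) →ₗ[R] (ι → R), ∀ x j, E x j = ε j (S 0 x j) :=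
    ⟨(LinearMap.pi fun j => ε j ∘ₗ LinearMap.proj j) ∘ₗ (S 0).toLinearMap, fun x j => by simp⟩
  refine ⟨D, E, ?_, ?_, ?_, ?_, ?_, ?_⟩
  · rintro ⟨j, i⟩ j' μ hμ
    rw [hE, hSs] at hμ
    by_cases hj : j' = j
    · subst hj
      rw [Pi.single_eq_same] at hμ
      simp [(h j').ge i μ hμ]
    · rw [Pi.single_eq_of_ne hj] at hμ
      simp at hμ
  · rintro k ⟨j, i⟩ ⟨j', i'⟩ μ hμ
    rw [← hS, hD, hSs] at hμ
    by_cases hj : j' = j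
    · subst hj
      rw [Pi.single_eq_same] at hμ
      have := (h j').gd k i i' μ hμ
      simp [← this, add_assoc]
    · rw [Pi.single_eq_of_ne hj] at hμ
      simp at hμ
  · rintro k ⟨j, i⟩ ⟨j', i'⟩
    rw [← hS, hD, hSs]
    by_cases hj : j' = j
    · subst hj
      rw [Pi.single_eq_same]
      exact (h j').mn k i i'
    · rw [Pi.single_eq_of_ne hj]
      simp
  · intro r
    choose x hx using fun j => (h j).se
    refine ⟨(S 0).symm (fun j => r j • x j), fun j => ?_⟩
    rw [hE, LinearEquiv.apply_symm_apply]
    have := (Jf j).mul_mem_left (r j) (hx j)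
    rw [mul_sub, mul_one] at this
    simpa using this
  · intro x
    constructor
    · rintro ⟨w, rfl⟩ j
      rw [hE, hD]
      exact ((h j).e0 _).1 ⟨_, rfl⟩
    · intro hx
      choose w hw using fun j => ((h j).e0 (S 0 x j)).2 (by rw [← hE]; exact hx j)
      refine ⟨(S 1).symm w, ?_⟩
      apply (S 0).injective
      funext j
      rw [hD]
      simp [hw]
  · intro k
    ext x
    constructor
    · rintro ⟨w, rfl⟩
      rw [LinearMap.mem_ker]
      apply (S k).injective
      funext j
      rw [hD, hD, map_zero, Pi.zero_apply, ← LinearMap.mem_ker, ← (h j).ex]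
      exact ⟨_, rfl⟩
    · intro hx
      rw [LinearMap.mem_ker] at hx
      have : ∀ j, S (k + 1) x j ∈ LinearMap.range (dm j (k + 1)) := by
        intro j
        rw [(h j).ex, LinearMap.mem_ker, ← hD, hx, map_zero, Pi.zero_apply]
      choose w hw using this
      refine ⟨(S (k + 2)).symm w, ?_⟩
      apply (S (k + 1)).injective
      funext j
      rw [hD]
      simp [hw]

lemma coeff_zero_of_lin {A B : Type}
    (D : (A →₀ MvPolynomial σ F) →ₗ[MvPolynomial σ F] (B →₀ MvPolynomial σ F))
    (h : ∀ i j, MvPolynomial.coeff 0 (D (Finsupp.single i 1) j) = 0) (x) (j : B) :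
    MvPolynomial.coeff 0 (D x j) = 0 := by
  induction x using Finsupp.induction_linear with
  | zero => simp
  | add f g hf hg => simp [hf, hg]
  | single i p =>
    have e1 : Finsupp.single i p = p • Finsupp.single i (1 : MvPolynomial σ F) := by simp
    rw [e1, map_smul, Finsupp.smul_apply, smul_eq_mul]
    have := h i j
    rw [← MvPolynomial.constantCoeff_eq] at this ⊢
    rw [map_mul, this, mul_zero]

theorem novar {J : Ideal (MvPolynomial σ F)}
    {X : ℕ → Type} {dg : ∀ k, X k → σ →₀ ℕ} {dm ε} (h : IsR J dg dm ε) (y : σ)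
    (hJ : ∀ f, MvPolynomial.X y * f ∈ J → f ∈ J) : ∀ k x, dg k x y = 0 := by
  have hc1 : ∀ (k : ℕ) (x : X k) (w : X k →₀ MvPolynomial σ F) (q : MvPolynomial σ F),
      MvPolynomial.coeff 0 q = 0 →
      Finsupp.single x 1 - q • w ∉ LinearMap.range (dm k) := by
    rintro k x w q hq ⟨v, hv⟩
    have h1 := coeff_zero_of_lin (dm k) (h.mn k) v x
    rw [hv] at h1
    rw [← MvPolynomial.constantCoeff_eq] at h1 hq
    simp [hq] at h1
  -- dividing a homogeneous element by the variable y
  have hdiv : ∀ k, (∀ x, dg k x y = 0) → ∀ (b : σ →₀ ℕ) (z : X k →₀ MvPolynomial σ F),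
      b y ≠ 0 → Hg (dg k) b z → ∃ z', z = (MvPolynomial.X y : MvPolynomial σ F) • z' := by
    intro k hk b z hb hz
    refine ⟨z.mapRange (fun p => p.divMonomial (Finsupp.single y 1)) (by simp), ?_⟩
    ext1 i
    rw [Finsupp.smul_apply, Finsupp.mapRange_apply, smul_eq_mul]
    have : (MvPolynomial.X y : MvPolynomial σ F) ∣ z i := by
      rw [MvPolynomial.X_dvd_iff_modMonomial_eq_zero]
      ext μ
      by_cases hle : Finsupp.single y 1 ≤ μ
      · rw [MvPolynomial.coeff_modMonomial_of_le _ hle]; simp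
      · rw [MvPolynomial.coeff_modMonomial_of_not_le _ hle]
        by_contra hne
        have h1 := hz i μ hne
        have h2 : μ y + dg k i y = b y := by rw [← h1]; rfl
        rw [hk, add_zero] at h2
        apply hle
        rw [Finsupp.single_le_iff]
        omega
    obtain ⟨q, hq⟩ := this
    rw [hq]
    congr 1
    exact (MvPolynomial.X_mul_divMonomial y q).symm
  intro k
  induction k with
  | zero =>
    intro x
    by_contra hx
    obtain ⟨w, hw⟩ := h.se
    apply hc1 0 x w (ε (Finsupp.single x 1))
    · by_contra hne
      apply hx
      rw [← h.ge x 0 hne]; rfl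
    · rw [h.e0]
      have := J.mul_mem_left (ε (Finsupp.single x 1)) hw
      rw [mul_sub, mul_one] at this
      simpa using this
  | succ k ih =>
    intro x
    by_contra hx
    obtain ⟨z', hz'⟩ := hdiv k ih _ _ hx (h.gd k x)
    have hz : z' ∈ LinearMap.range (dm k) := by
      cases k with
      | zero =>
        rw [h.e0]
        apply hJ
        rw [← smul_eq_mul, ← map_smul, ← hz', ← h.e0]
        exact ⟨_, rfl⟩
      | succ k =>
        rw [h.ex, LinearMap.mem_ker]
        have h1 : (MvPolynomial.X y : MvPolynomial σ F) • dm k z' = 0 := by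
          rw [← map_smul, ← hz', ← LinearMap.mem_ker, ← h.ex]
          exact ⟨_, rfl⟩
        exact (smul_eq_zero.1 h1).resolve_left (MvPolynomial.X_ne_zero y)
    obtain ⟨w, hw⟩ := hz
    apply hc1 (k + 1) x w (MvPolynomial.X y)
    · simp
    · rw [h.ex, LinearMap.mem_ker, map_sub, map_smul, hw, hz', sub_self]

lemma isMin_iff (J : Ideal (MvPolynomial σ F)) (β : ℕ → (σ →₀ ℕ) → ℕ) :
    IsMinFreeRes σ F (id : (σ →₀ ℕ) → (σ →₀ ℕ)) J β ↔
    ∃ dm ε, IsR J (X := fun k => Σ a : σ →₀ ℕ, Fin (β k a)) (fun _ x => x.1) dm ε := by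
  have key : ∀ ε : FMod σ F (β 0) →ₗ[MvPolynomial σ F] MvPolynomial σ F,
      LinearMap.range ε ⊔ (J : Submodule (MvPolynomial σ F) (MvPolynomial σ F)) = ⊤ ↔
      ∃ x, 1 - ε x ∈ J := by
    intro ε
    constructor
    · intro h
      have h1 : (1 : MvPolynomial σ F) ∈ LinearMap.range ε ⊔ (J : Submodule _ _) := by
        rw [h]; trivial
      obtain ⟨_, ⟨x, rfl⟩, b, hb, hab⟩ := Submodule.mem_sup.1 h1
      refine ⟨x, ?_⟩
      rw [← hab]; simpa using hb
    · rintro ⟨x, hx⟩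
      have : (LinearMap.range ε ⊔ (J : Submodule _ _) : Ideal (MvPolynomial σ F)) = ⊤ := by
        rw [Ideal.eq_top_iff_one]
        have := Submodule.add_mem_sup (S := LinearMap.range ε) ⟨x, rfl⟩ hx
        simpa using this
      exact this
  constructor
  · rintro ⟨dm, ε, h1, h2, h3, h4, h5, h6⟩
    refine ⟨dm, ε, ?_, ?_, ?_, (key ε).1 h4, ?_, h6⟩
    · rintro ⟨a, i⟩ μ h
      exact h1 a i μ h
    · rintro k ⟨a, i⟩ ⟨b, j⟩ μ h
      exact h2 k a i b j μ h
    · rintro k ⟨a, i⟩ ⟨b, j⟩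
      exact h3 k a i b j
    · intro x
      rw [h5]; rfl
  · rintro ⟨dm, ε, h⟩
    refine ⟨dm, ε, ?_, ?_, ?_, (key ε).2 h.se, ?_, h.ex⟩
    · intro a i μ hh
      exact h.ge ⟨a, i⟩ μ hh
    · intro k a i b j μ hh
      exact h.gd k ⟨a, i⟩ ⟨b, j⟩ μ hh
    · intro k a i b j
      exact h.mn k ⟨a, i⟩ ⟨b, j⟩
    · ext x
      rw [h.e0]; rfl

/-- A graded set with prescribed fiber cardinalities. -/
lemma fiberEquiv {D W : Type} (g : W → D) (β : D → ℕ)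
    (h : ∀ a, Nonempty ({w // g w = a} ≃ Fin (β a))) :
    ∃ e : (Σ a, Fin (β a)) ≃ W, ∀ x, g (e x) = x.1 := by
  let f := fun a => (h a).some
  refine ⟨(Equiv.sigmaCongrRight fun a => (f a).symm).trans (Equiv.sigmaFiberEquiv g), ?_⟩
  rintro ⟨a, i⟩
  exact ((f a).symm i).2

lemma fib1 {D : Type} (β : D → ℕ) (a : D) :
    Nat.card {w : Σ a, Fin (β a) // w.1 = a} = β a ∧ Finite {w : Σ a, Fin (β a) // w.1 = a} := by
  let e : {w : Σ a, Fin (β a) // w.1 = a} ≃ Fin (β a) := Equiv.sigmaSubtype a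
  exact ⟨by rw [Nat.card_congr e]; simp, Finite.of_equiv _ e.symm⟩

lemma fib2 (β : (σ →₀ ℕ) → ℕ) (s a : σ →₀ ℕ) :
    Nat.card {w : Σ a, Fin (β a) // w.1 + s = a} = (if s ≤ a then β (a - s) else 0) ∧
    Finite {w : Σ a, Fin (β a) // w.1 + s = a} := by
  by_cases h : s ≤ a
  · have : ∀ w : (Σ a, Fin (β a)), w.1 + s = a ↔ w.1 = a - s := by
      intro w
      constructor
      · intro h; rw [← h]; simp
      · intro h'; rw [h']; exact tsub_add_cancel_of_le h
    simp only [this, if_pos h]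
    exact fib1 β (a - s)
  · have : IsEmpty {w : Σ a, Fin (β a) // w.1 + s = a} := by
      constructor
      rintro ⟨w, hw⟩
      exact h (hw ▸ le_add_self)
    exact ⟨by simp [h], inferInstance⟩

lemma fib3 {ι : Type} [Fintype ι] (β : (σ →₀ ℕ) → ℕ) (βj : ι → (σ →₀ ℕ) → ℕ) (s : ι → σ →₀ ℕ)
    (a : σ →₀ ℕ) :
    Nonempty ({w : (Σ a, Fin (β a)) ⊕ (Σ j, Σ a, Fin (βj j a)) //
      Sum.elim (fun x => x.1) (fun x => x.2.1 + s x.1) w = a} ≃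
      Fin (β a + ∑ j, if s j ≤ a then βj j (a - s j) else 0)) := by
  have f1 := fib1 β a
  have f2 := fun j => fib2 (βj j) (s j) a
  have := f1.2
  have := fun j => (f2 j).2
  let e : {w : (Σ a, Fin (β a)) ⊕ (Σ j, Σ a, Fin (βj j a)) //
      Sum.elim (fun x => x.1) (fun x => x.2.1 + s x.1) w = a} ≃
      {w : Σ a, Fin (β a) // w.1 = a} ⊕
        (Σ j, {w : Σ a, Fin (βj j a) // w.1 + s j = a}) :=
    { toFun := fun w => match w with
        | ⟨Sum.inl x, h⟩ => Sum.inl ⟨x, h⟩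
        | ⟨Sum.inr ⟨j, x⟩, h⟩ => Sum.inr ⟨j, ⟨x, h⟩⟩
      invFun := fun w => match w with
        | Sum.inl ⟨x, h⟩ => ⟨Sum.inl x, h⟩
        | Sum.inr ⟨j, ⟨x, h⟩⟩ => ⟨Sum.inr ⟨j, x⟩, h⟩
      left_inv := by rintro ⟨x | ⟨j, x⟩, h⟩ <;> rfl
      right_inv := by rintro (⟨x, h⟩ | ⟨j, ⟨x, h⟩⟩) <;> rfl }
  have hf : Finite {w : (Σ a, Fin (β a)) ⊕ (Σ j, Σ a, Fin (βj j a)) //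
      Sum.elim (fun x => x.1) (fun x => x.2.1 + s x.1) w = a} := Finite.of_equiv _ e.symm
  refine ⟨(Finite.equivFin _).trans (finCongr ?_)⟩
  rw [Nat.card_congr e, Nat.card_sum, f1.1, Nat.card_sigma]
  simp only [(f2 _).1]

theorem cone_table {J : Ideal (MvPolynomial σ F)} {Q : (σ →₀ ℕ) → Prop} (hQ : IsMI J Q)
    {ι : Type} [Fintype ι] {Jf : ι → Ideal (MvPolynomial σ F)} {s : ι → σ →₀ ℕ}
    {β β' : ℕ → (σ →₀ ℕ) → ℕ} {βj : ι → ℕ → (σ →₀ ℕ) → ℕ}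
    (h : IsMinFreeRes σ F (id : (σ →₀ ℕ) → (σ →₀ ℕ)) J β)
    (hj : ∀ j, IsMinFreeRes σ F (id : (σ →₀ ℕ) → (σ →₀ ℕ)) (Jf j) (βj j))
    (hcol : ∀ j, ∀ r ∈ Jf j, r * MvPolynomial.monomial (s j) 1 ∈ J)
    (hind : ∀ r : ι → MvPolynomial σ F, ∑ j, r j * MvPolynomial.monomial (s j) 1 ∈ J →
      ∀ j, r j ∈ Jf j)
    (y : σ) (hy : ∀ f, MvPolynomial.X y * f ∈ J → f ∈ J) (hys : ∀ j, s j y ≠ 0)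
    (h0 : ∀ a, β' 0 a = β 0 a)
    (hS : ∀ k a, β' (k + 1) a = β (k + 1) a + ∑ j, if s j ≤ a then βj j k (a - s j) else 0) :
    IsMinFreeRes σ F (id : (σ →₀ ℕ) → (σ →₀ ℕ))
      (J ⊔ Ideal.span (Set.range fun j => MvPolynomial.monomial (s j) (1 : F))) β' := by
  rw [isMin_iff] at h ⊢
  obtain ⟨dm, ε, h⟩ := h
  obtain ⟨dY, εY, hY⟩ := sumRes (Jf := Jf) (X := fun j k => Σ a, Fin (βj j k a))
    (dg := fun j k x => x.1) s (fun j => (isMin_iff _ _).1 (hj j))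
  have hn := novar h y hy
  obtain ⟨e0, he0⟩ := fiberEquiv (fun x : (Σ a, Fin (β 0 a)) => x.1) (β' 0) (fun a => by
    rw [h0]; exact ⟨Equiv.sigmaSubtype a⟩)
  have hSe := fun k => fiberEquiv
    (Sum.elim (fun x : (Σ a, Fin (β (k + 1) a)) => x.1)
      (fun x : (Σ j, Σ a, Fin (βj j k a)) => x.2.1 + s x.1)) (β' (k + 1)) (fun a => by
      rw [hS]; exact fib3 _ _ _ _)
  choose eS heS using hSe
  refine cone_res (Z := fun k => Σ a, Fin (β' k a)) hQ h hY hcol hind ?_ e0 ?_ eS ?_ ?_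
  · intro k x z hxz
    have h1 := hn k x
    rw [hxz] at h1
    have h2 := hys z.1
    simp at h1
    exact h2 h1.2
  · intro x
    rw [← he0]; simp
  · intro k x
    rw [← heS]; simp
  · intro k x
    rw [← heS]; simp

end res2

section p4
variable {d : ℕ} {m : Fin d → ℕ} {F : Type*} [Field F]

def yv (v : Var d m) : Vtx d m := ⟨v.1, Fin.last (m v.1)⟩

def sv (v : Var d m) : Vtx d m →₀ ℕ := Finsupp.single (emb v) 1 + Finsupp.single (yv v) 1

def uA (A : Finset (Var d m)) : Vtx d m →₀ ℕ := ∑ v ∈ A, Finsupp.single (emb v) 1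

lemma emb_ne_last (v : Var d m) (i : Fin d) : emb v ≠ (⟨i, Fin.last (m i)⟩ : Vtx d m) := by
  obtain ⟨i', j⟩ := v
  intro h
  simp only [emb, Sigma.mk.injEq] at h
  obtain ⟨rfl, h⟩ := h
  exact (Fin.castSucc_lt_last j).ne (eq_of_heq h)

lemma emb_ne_yv (v w : Var d m) : emb v ≠ yv w := emb_ne_last v w.1

lemma emb_inj {v w : Var d m} (h : emb v = emb w) : v = w := by
  obtain ⟨i, j⟩ := v
  obtain ⟨i', j'⟩ := w
  simp only [emb, Sigma.mk.injEq] at h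
  obtain ⟨rfl, h⟩ := h
  rw [Fin.castSucc_injective _ (eq_of_heq h)]

lemma yv_eq {v w : Var d m} : yv v = yv w ↔ v.1 = w.1 := by
  constructor
  · intro h; exact congrArg (fun z : Vtx d m => z.1) h
  · intro h
    unfold yv
    rw [h]

lemma two_le {σ : Type} {a b : σ} (h : a ≠ b) (w : σ →₀ ℕ) :
    Finsupp.single a 1 + Finsupp.single b 1 ≤ w ↔ w a ≠ 0 ∧ w b ≠ 0 := by
  constructor
  · intro hh
    have h1 := hh a
    have h2 := hh b
    simp at h1 h2
    omega
  · rintro ⟨h1, h2⟩ c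
    simp only [Finsupp.add_apply, Finsupp.single_apply]
    split_ifs with h3 h4 h4
    · exact absurd (h3.trans h4.symm) h
    · subst h3; omega
    · subst h4; omega
    · omega

lemma sv_le (v : Var d m) (w) : sv v ≤ w ↔ w (emb v) ≠ 0 ∧ w (yv v) ≠ 0 :=
  two_le (emb_ne_yv v v) w

lemma sv_emb (v w : Var d m) : sv v (emb w) = if v = w then 1 else 0 := by
  have : emb v = emb w ↔ v = w := ⟨emb_inj, fun h => by rw [h]⟩
  simp [sv, Finsupp.single_apply, this, (emb_ne_yv w v).symm]

lemma sv_yv (v w : Var d m) : sv v (yv w) = if v.1 = w.1 then 1 else 0 := by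
  simp [sv, Finsupp.single_apply, yv_eq, (emb_ne_yv v w)]

lemma uA_insert {v : Var d m} {A} (h : v ∉ A) :
    uA (insert v A) = Finsupp.single (emb v) 1 + uA A := Finset.sum_insert h

lemma uA_emb (A : Finset (Var d m)) (v) : uA A (emb v) = if v ∈ A then 1 else 0 := by
  have h : ∀ w : Var d m, emb w = emb v ↔ w = v := fun w => ⟨emb_inj, fun h => by rw [h]⟩
  simp [uA, Finsupp.finsetSum_apply, Finsupp.single_apply, h]

lemma shift_insert {v : Var d m} {A} (h : v ∉ A) :
    shiftDeg (insert v A) = sv v + shiftDeg A := Finset.sum_insert h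

structure Good (Q : (Vtx d m →₀ ℕ) → Prop) : Prop where
  mono : ∀ w w', (∀ v, w (emb v) ≤ w' (emb v)) → Q w → Q w'
  br : ∀ w (v v' : Var d m), v.1 = v'.1 → v ≠ v' → w (emb v) ≠ 0 → w (emb v') ≠ 0 → Q w

lemma br_MI : IsMI (brIdeal (d := d) (m := m) F)
    (fun w => ∃ v v' : Var d m, v.1 = v'.1 ∧ v ≠ v' ∧ w (emb v) ≠ 0 ∧ w (emb v') ≠ 0) := by
  have h1 : brIdeal (d := d) (m := m) F = Ideal.span ((fun s => MvPolynomial.monomial s (1 : F)) ''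
      {w | ∃ (i : Fin d) (j k : Fin (m i)), j < k ∧ w = Finsupp.single (emb ⟨i, j⟩) 1 +
        Finsupp.single (emb ⟨i, k⟩) 1}) := by
    unfold brIdeal
    congr 1
    ext p
    constructor
    · rintro ⟨i, j, k, hjk, rfl⟩
      refine ⟨_, ⟨i, j, k, hjk, rfl⟩, ?_⟩
      simp [MvPolynomial.X, emb, MvPolynomial.monomial_mul]
    · rintro ⟨_, ⟨i, j, k, hjk, rfl⟩, rfl⟩
      refine ⟨i, j, k, hjk, ?_⟩
      simp [MvPolynomial.X, emb, MvPolynomial.monomial_mul]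
  rw [h1]
  refine (IsMI_span _).congr fun w => ?_
  have hne : ∀ (i : Fin d) (j k : Fin (m i)), j ≠ k → emb (⟨i, j⟩ : Var d m) ≠ emb ⟨i, k⟩ := by
    intro i j k h h'
    have := emb_inj h'
    simp at this
    exact h this
  constructor
  · rintro ⟨_, ⟨i, j, k, hjk, rfl⟩, hw⟩
    rw [two_le (hne i j k hjk.ne)] at hw
    refine ⟨⟨i, j⟩, ⟨i, k⟩, rfl, ?_, hw⟩
    intro h
    simp at h
    exact hjk.ne h
  · rintro ⟨⟨i, j⟩, ⟨i', k⟩, hi, hv, h1, h2⟩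
    simp only at hi
    subst hi
    have hjk : j ≠ k := by rintro rfl; exact hv rfl
    rcases lt_or_gt_of_ne hjk with h | h
    · exact ⟨_, ⟨i, j, k, h, rfl⟩, (two_le (hne i j k h.ne) w).2 ⟨h1, h2⟩⟩
    · exact ⟨_, ⟨i, k, j, h, rfl⟩, (two_le (hne i k j h.ne) w).2 ⟨h2, h1⟩⟩

lemma last_MI : IsMI (lastIdeal (d := d) (m := m) F) (fun w => ∃ v : Var d m, sv v ≤ w) := by
  have h1 : lastIdeal (d := d) (m := m) F = Ideal.span
      ((fun s => MvPolynomial.monomial s (1 : F)) '' Set.range sv) := by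
    unfold lastIdeal
    congr 1
    ext p
    constructor
    · rintro ⟨i, j, rfl⟩
      refine ⟨_, ⟨⟨i, j⟩, rfl⟩, ?_⟩
      simp [MvPolynomial.X, emb, MvPolynomial.monomial_mul, sv, yv, add_comm]
    · rintro ⟨_, ⟨⟨i, j⟩, rfl⟩, rfl⟩
      refine ⟨i, j, ?_⟩
      simp [MvPolynomial.X, emb, MvPolynomial.monomial_mul, sv, yv, add_comm]
  rw [h1]
  refine (IsMI_span _).congr fun w => ?_
  simp

lemma ext_good (S : Set (Mon d m)) (I : Ideal (PR d m F)) (hI : I = Ideal.span (mon F '' S)) :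
    ∃ Q, Good Q ∧ IsMI (extBr F I) Q := by
  have h1 : Ideal.map (MvPolynomial.rename (emb : Var d m → Vtx d m)) I =
      Ideal.span ((fun s => MvPolynomial.monomial s (1 : F)) ''
        ((fun s => Finsupp.mapDomain emb s) '' S)) := by
    rw [hI, Ideal.map_span, Set.image_image, Set.image_image]
    congr 1
    apply Set.image_congr
    intro s _
    simp [mon, MvPolynomial.rename_monomial]
  have hinj : Function.Injective (emb : Var d m → Vtx d m) := fun _ _ => emb_inj
  refine ⟨_, ?_, ((h1 ▸ IsMI_span _ :
    IsMI (Ideal.map (MvPolynomial.rename (emb : Var d m → Vtx d m)) I) _)).sup br_MI⟩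
  constructor
  · rintro w w' h (⟨_, ⟨s, hs, rfl⟩, hw⟩ | ⟨v, v', h1, h2, h3, h4⟩)
    · left
      refine ⟨_, ⟨s, hs, rfl⟩, ?_⟩
      intro c
      by_cases hc : c ∈ Set.range (emb : Var d m → Vtx d m)
      · obtain ⟨v, rfl⟩ := hc
        exact (hw _).trans (h v)
      · simp only
        rw [Finsupp.mapDomain_of_notMem_range _ _ hc]
        exact Nat.zero_le _
    · right
      refine ⟨v, v', h1, h2, ?_, ?_⟩
      · have := h v; omega
      · have := h v'; omega
  · intro w v v' h1 h2 h3 h4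
    exact Or.inr ⟨v, v', h1, h2, h3, h4⟩

lemma MI_mul_mono {σ : Type} {J : Ideal (MvPolynomial σ F)} {Q} (h : IsMI J Q) (s : σ →₀ ℕ) (f) :
    f * MvPolynomial.monomial s 1 ∈ J ↔ ∀ w, MvPolynomial.coeff w f ≠ 0 → Q (w + s) := by
  rw [h]
  constructor
  · intro hh w hw
    apply hh
    rw [MvPolynomial.coeff_mul_monomial, mul_one]
    exact hw
  · intro hh w hw
    rw [MvPolynomial.coeff_mul_monomial'] at hw
    split_ifs at hw with h1
    · have := hh (w - s) (by simpa using hw)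
      rwa [tsub_add_cancel_of_le h1] at this
    · exact absurd rfl hw

lemma colon_MI {J : Ideal (Pp d m F)} {Q} (h : IsMI J Q) (A : Finset (Var d m)) :
    IsMI (colonOf F J A) (fun w => Q (w + uA A)) := by
  intro f
  rw [← MI_mul_mono h]
  unfold colonOf
  rw [Submodule.mem_colon]
  constructor
  · intro hh
    exact hh (monA F A) (Ideal.subset_span rfl)
  · intro hh p hp
    obtain ⟨q, rfl⟩ := Ideal.mem_span_singleton'.1 hp
    have := J.mul_mem_left q hh
    rw [smul_eq_mul]
    convert this using 1
    unfold monA uA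
    ring

def LC (F : Type*) [Field F] (C : Finset (Fin d)) : Ideal (Pp d m F) :=
  Ideal.span ((fun s => MvPolynomial.monomial s (1 : F)) '' {w | ∃ v : Var d m, v.1 ∈ C ∧ w = sv v})

lemma LC_MI (C : Finset (Fin d)) :
    IsMI (LC (m := m) F C) (fun w => ∃ v : Var d m, v.1 ∈ C ∧ sv v ≤ w) := by
  refine (IsMI_span _).congr fun w => ?_
  constructor
  · rintro ⟨_, ⟨v, hv, rfl⟩, h⟩; exact ⟨v, hv, h⟩
  · rintro ⟨v, hv, h⟩; exact ⟨_, ⟨v, hv, rfl⟩, h⟩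

def csfC (m : Fin d → ℕ) (C : Finset (Fin d)) : Finset (Finset (Var d m)) :=
  Finset.univ.filter (fun B : Finset (Var d m) => CSFSet B ∧ ∀ v ∈ B, v.1 ∈ C)

lemma mem_csfC {C : Finset (Fin d)} {B : Finset (Var d m)} :
    B ∈ csfC m C ↔ CSFSet B ∧ ∀ v ∈ B, v.1 ∈ C := by simp [csfC]

lemma CSF_insert {v : Var d m} {B : Finset (Var d m)} (hB : CSFSet B) (hv : ∀ w ∈ B, w.1 ≠ v.1) :
    CSFSet (insert v B) := by
  intro a ha b hb hab
  rw [Finset.mem_insert] at ha hb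
  rcases ha with rfl | ha <;> rcases hb with rfl | hb
  · rfl
  · exact absurd hab.symm (hv b hb)
  · exact absurd hab (hv a ha)
  · exact hB a ha b hb hab

lemma csfC_split (C : Finset (Fin d)) (i : Fin d) (hi : i ∉ C) (G : Finset (Var d m) → ℕ) :
    ∑ B ∈ csfC m (insert i C), G B = ∑ B ∈ csfC m C, G B +
      ∑ j : Fin (m i), ∑ B ∈ csfC m C, G (insert ⟨i, j⟩ B) := by
  rw [← Finset.sum_filter_add_sum_filter_not (csfC m (insert i C)) (fun B => ∀ v ∈ B, v.1 ≠ i)]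
  congr 1
  · apply Finset.sum_congr _ (fun _ _ => rfl)
    ext B
    simp only [Finset.mem_filter, mem_csfC, Finset.mem_insert]
    constructor
    · rintro ⟨⟨h1, h2⟩, h3⟩
      exact ⟨h1, fun v hv => (h2 v hv).resolve_left (h3 v hv)⟩
    · rintro ⟨h1, h2⟩
      refine ⟨⟨h1, fun v hv => Or.inr (h2 v hv)⟩, fun v hv h => hi (h ▸ h2 v hv)⟩
  · rw [← Finset.sum_product' Finset.univ (csfC m C) (fun j B => G (insert ⟨i, j⟩ B))]
    symm
    have hnot : ∀ (B : Finset (Var d m)) (j : Fin (m i)), B ∈ csfC m C → (⟨i, j⟩ : Var d m) ∉ B :=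
      fun B j hB h => hi ((mem_csfC.1 hB).2 _ h)
    apply Finset.sum_nbij (fun p => insert (⟨i, p.1⟩ : Var d m) p.2)
    · rintro ⟨j, B⟩ hB
      have hB : B ∈ csfC m C := by simpa using hB
      have hB' := mem_csfC.1 hB
      simp only [Finset.mem_filter, mem_csfC]
      refine ⟨⟨CSF_insert hB'.1 ?_, ?_⟩, ?_⟩
      · intro w hw h
        exact hi (by rw [show i = w.1 from h.symm]; exact hB'.2 w hw)
      · intro v hv
        rcases Finset.mem_insert.1 hv with rfl | hv
        · simp
        · exact Finset.mem_insert_of_mem (hB'.2 v hv)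
      · intro h
        exact h _ (Finset.mem_insert_self _ _) rfl
    · rintro ⟨j, B⟩ hB0 ⟨j', B'⟩ hB0' h
      have hB : B ∈ csfC m C := by simpa using hB0
      have hB' : B' ∈ csfC m C := by simpa using hB0'
      simp only at h
      have hj : j = j' := by
        have : (⟨i, j⟩ : Var d m) ∈ insert (⟨i, j'⟩ : Var d m) B' := h ▸ Finset.mem_insert_self _ _
        rcases Finset.mem_insert.1 this with h1 | h1
        · simpa using h1
        · exact absurd h1 (hnot _ _ hB')
      subst hj
      have : B = B' := by
        rw [← Finset.erase_insert (hnot B j hB), h, Finset.erase_insert (hnot B' j hB')]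
      rw [this]
    · intro B hB
      simp only [Finset.coe_filter, Set.mem_ofPred_eq, mem_csfC] at hB
      obtain ⟨⟨h1, h2⟩, h3⟩ := hB
      push Not at h3
      obtain ⟨⟨i', j⟩, hv, hvi⟩ := h3
      simp only at hvi
      subst hvi
      refine ⟨(j, B.erase ⟨i', j⟩), ?_, Finset.insert_erase hv⟩
      simp only [Finset.coe_product, Set.mem_prod, Finset.mem_coe, Finset.mem_univ, true_and,
        mem_csfC]
      refine ⟨fun a ha b hb => h1 a (Finset.mem_of_mem_erase ha) b (Finset.mem_of_mem_erase hb),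
        fun v hv' => ?_⟩
      have h4 := h2 v (Finset.mem_of_mem_erase hv')
      rcases Finset.mem_insert.1 h4 with h5 | h5
      · exact absurd (h1 v (Finset.mem_of_mem_erase hv') _ hv h5) (Finset.ne_of_mem_erase hv')
      · exact h5
    · intro _ _; rfl

def βT (βu : Finset (Var d m) → ℕ → (Vtx d m →₀ ℕ) → ℕ) (C : Finset (Fin d))
    (A : Finset (Var d m)) (k : ℕ) (a : Vtx d m →₀ ℕ) : ℕ :=
  ∑ B ∈ csfC m C, if B.card ≤ k ∧ shiftDeg B ≤ a then
    βu (A ∪ B) (k - B.card) (a - shiftDeg B) else 0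

lemma csfC_empty : csfC m (∅ : Finset (Fin d)) = {∅} := by
  ext B
  rw [mem_csfC, Finset.mem_singleton]
  constructor
  · rintro ⟨_, h⟩
    exact Finset.eq_empty_of_forall_notMem fun v hv => absurd (h v hv) (by simp)
  · rintro rfl
    exact ⟨fun v hv => absurd hv (by simp), fun v hv => absurd hv (by simp)⟩

theorem partb_step {J : Ideal (Pp d m F)} {Q} (hJ : IsMI J Q) (hQ : Good Q)
    (βu : Finset (Var d m) → ℕ → (Vtx d m →₀ ℕ) → ℕ)
    (hβ : ∀ A : Finset (Var d m), CSFSet A →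
        IsMinFreeRes (Vtx d m) F (id : (Vtx d m →₀ ℕ) → (Vtx d m →₀ ℕ))
          (colonOf F J A) (βu A)) (C : Finset (Fin d)) :
    ∀ A : Finset (Var d m), CSFSet A → (∀ v ∈ A, v.1 ∉ C) →
      IsMinFreeRes (Vtx d m) F (id : (Vtx d m →₀ ℕ) → (Vtx d m →₀ ℕ))
          (colonOf F J A ⊔ LC F C) (βT βu C A) := by
  induction C using Finset.induction_on with
  | empty =>
    intro A hA _
    have h1 : βT βu ∅ A = βu A := by
      funext k a
      simp [βT, csfC_empty, shiftDeg]
    have h2 : LC (m := m) F ∅ = ⊥ := by simp [LC]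
    rw [h1, h2, sup_bot_eq]
    exact hβ A hA
  | insert i C hi ih =>
    intro A hA hAC
    have hvA : ∀ j : Fin (m i), (⟨i, j⟩ : Var d m) ∉ A := fun j h =>
      hAC _ h (Finset.mem_insert_self _ _)
    have hMI := fun A => (colon_MI hJ A).sup (LC_MI (m := m) (F := F) C)
    have e1 : colonOf F J A ⊔ LC F (insert i C) = (colonOf F J A ⊔ LC F C) ⊔
        Ideal.span (Set.range fun j : Fin (m i) =>
          MvPolynomial.monomial (sv (⟨i, j⟩ : Var d m)) (1 : F)) := by
      rw [sup_assoc]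
      congr 1
      unfold LC
      rw [← Ideal.span_union]
      congr 1
      ext p
      constructor
      · rintro ⟨_, ⟨⟨i', j⟩, hv, rfl⟩, rfl⟩
        rcases Finset.mem_insert.1 hv with h | h
        · simp only at h
          subst h
          exact Or.inr ⟨j, rfl⟩
        · exact Or.inl ⟨_, ⟨_, h, rfl⟩, rfl⟩
      · rintro (⟨_, ⟨v, hv, rfl⟩, rfl⟩ | ⟨j, rfl⟩)
        · exact ⟨_, ⟨v, Finset.mem_insert_of_mem hv, rfl⟩, rfl⟩
        · exact ⟨_, ⟨⟨i, j⟩, Finset.mem_insert_self _ _, rfl⟩, rfl⟩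
    rw [e1]
    refine cone_table (hMI A) (Jf := fun j => colonOf F J (insert ⟨i, j⟩ A) ⊔ LC F C)
      (βj := fun j => βT βu C (insert ⟨i, j⟩ A)) (ih A hA ?_) ?_ ?_ ?_ ⟨i, Fin.last (m i)⟩ ?_ ?_ ?_ ?_
    · intro v hv h
      exact hAC v hv (Finset.mem_insert_of_mem h)
    · intro j
      apply ih
      · apply CSF_insert hA
        rintro w hw rfl
        exact hAC w hw (Finset.mem_insert_self _ _)
      · intro v hv h
        rcases Finset.mem_insert.1 hv with rfl | hv
        · exact hi h
        · exact hAC v hv (Finset.mem_insert_of_mem h)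
    · intro j r hr
      rw [MI_mul_mono (hMI A)]
      intro w hw
      rcases ((hMI _) r).1 hr w hw with h | ⟨v, hv, h⟩
      · left
        refine hQ.mono _ _ (fun v => ?_) h
        rw [uA_insert (hvA j)]
        simp only [Finsupp.add_apply, sv]
        omega
      · right
        exact ⟨v, hv, h.trans le_self_add⟩
    · intro r hr j
      rw [hMI]
      intro w hw
      by_cases hbr : ∃ j', j' ≠ j ∧ w (emb ⟨i, j'⟩) ≠ 0
      · left
        obtain ⟨j', hj', hw'⟩ := hbr
        refine hQ.br _ ⟨i, j⟩ ⟨i, j'⟩ rfl ?_ ?_ ?_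
        · intro h
          apply hj'
          simpa using h.symm
        · rw [uA_insert (hvA j)]
          simp
        · simp only [Finsupp.add_apply]; omega
      · push Not at hbr
        have hc : MvPolynomial.coeff (w + sv ⟨i, j⟩)
            (∑ j, r j * MvPolynomial.monomial (sv (⟨i, j⟩ : Var d m)) 1) ≠ 0 := by
          rw [MvPolynomial.coeff_sum, Finset.sum_eq_single j]
          · rw [MvPolynomial.coeff_mul_monomial, mul_one]; exact hw
          · intro j' _ hj'
            rw [MvPolynomial.coeff_mul_monomial', if_neg]
            intro hle
            have h1 := ((sv_le _ _).1 hle).1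
            apply h1
            rw [Finsupp.add_apply, hbr j' hj', sv_emb, if_neg]
            intro h
            apply hj'
            simpa using h.symm
          · simp
        rcases ((hMI A) _).1 hr _ hc with h | ⟨v, hv, h⟩
        · left
          refine hQ.mono _ _ (fun v => ?_) h
          rw [uA_insert (hvA j)]
          have : sv ⟨i, j⟩ (emb v) = Finsupp.single (emb (⟨i, j⟩ : Var d m)) 1 (emb v) := by
            rw [sv, Finsupp.add_apply, Finsupp.single_apply (a := yv _), if_neg, add_zero]
            exact (emb_ne_yv _ _).symm
          simp only [Finsupp.add_apply, this]
          omega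
        · right
          refine ⟨v, hv, ?_⟩
          have hne : (⟨i, j⟩ : Var d m).1 ≠ v.1 := fun h => hi (by rw [show i = v.1 from h]; exact hv)
          rw [sv_le] at h ⊢
          rw [Finsupp.add_apply, Finsupp.add_apply, sv_emb, sv_yv, if_neg hne, if_neg] at h
          · simpa using h
          · rintro rfl; exact hne rfl
    · intro f hf
      rw [hMI]
      intro w hw
      have : MvPolynomial.coeff (w + Finsupp.single (⟨i, Fin.last (m i)⟩ : Vtx d m) 1)
          (MvPolynomial.X (⟨i, Fin.last (m i)⟩ : Vtx d m) * f) ≠ 0 := by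
        rw [add_comm, MvPolynomial.coeff_X_mul]; exact hw
      rcases ((hMI A) _).1 hf _ this with h | ⟨v, hv, h⟩
      · left
        refine hQ.mono _ _ (fun v => ?_) h
        simp [Finsupp.single_apply, (emb_ne_last v i).symm]
      · right
        refine ⟨v, hv, ?_⟩
        have hne : (⟨i, Fin.last (m i)⟩ : Vtx d m) ≠ yv v := by
          intro h
          have : i = v.1 := congrArg Sigma.fst h
          exact hi (this ▸ hv)
        rw [sv_le] at h ⊢
        rw [Finsupp.add_apply, Finsupp.add_apply, Finsupp.single_apply, Finsupp.single_apply,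
          if_neg hne, if_neg (emb_ne_last v i).symm] at h
        simpa using h
    · intro j
      have := sv_yv (⟨i, j⟩ : Var d m) ⟨i, j⟩
      rw [if_pos rfl] at this
      change sv (⟨i, j⟩ : Var d m) (yv ⟨i, j⟩) ≠ 0
      omega
    · intro a
      unfold βT
      rw [csfC_split C i hi, add_eq_left]
      apply Finset.sum_eq_zero
      intro j _
      apply Finset.sum_eq_zero
      intro B hB
      rw [if_neg]
      rintro ⟨h, _⟩
      simp at h
    · intro k a
      unfold βT
      rw [csfC_split C i hi]
      congr 1
      apply Finset.sum_congr rfl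
      intro j _
      split_ifs with h
      · apply Finset.sum_congr rfl
        intro B hB
        have hn : (⟨i, j⟩ : Var d m) ∉ B := fun h => hi ((mem_csfC.1 hB).2 _ h)
        have hle : shiftDeg B ≤ a - sv ⟨i, j⟩ ↔ sv ⟨i, j⟩ + shiftDeg B ≤ a := le_tsub_iff_left h
        rw [Finset.card_insert_of_notMem hn, shift_insert hn, Nat.add_sub_add_right,
          ← tsub_tsub, Finset.insert_union, Finset.union_insert]
        simp only [hle, Nat.add_le_add_iff_right]
      · apply Finset.sum_eq_zero
        intro B hB
        have hn : (⟨i, j⟩ : Var d m) ∉ B := fun h => hi ((mem_csfC.1 hB).2 _ h)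
        rw [if_neg]
        rw [shift_insert hn]
        rintro ⟨_, h'⟩
        exact h (le_self_add.trans h')

lemma CSF_card {A : Finset (Var d m)} (hA : CSFSet A) : A.card ≤ d := by
  have := Finset.card_le_card_of_injOn (s := A) (t := (Finset.univ : Finset (Fin d)))
    (fun v => v.1) (fun _ _ => by simp) (fun v hv w hw h => hA v hv w hw h)
  simpa using this

theorem partb {J : Ideal (Pp d m F)} {Q} (hJ : IsMI J Q) (hQ : Good Q)
    (βu : Finset (Var d m) → ℕ → (Vtx d m →₀ ℕ) → ℕ)
    (hβ : ∀ A : Finset (Var d m), CSFSet A →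
        IsMinFreeRes (Vtx d m) F (id : (Vtx d m →₀ ℕ) → (Vtx d m →₀ ℕ))
          (colonOf F J A) (βu A)) :
    IsMinFreeRes (Vtx d m) F (id : (Vtx d m →₀ ℕ) → (Vtx d m →₀ ℕ))
        (J ⊔ lastIdeal F)
        (fun k a => ∑ j ∈ Finset.range (d + 1),
          ∑ A ∈ Finset.univ.filter
            (fun A : Finset (Var d m) => CSFSet A ∧ A.card = j),
            if j ≤ k ∧ shiftDeg A ≤ a then βu A (k - j) (a - shiftDeg A) else 0) := by
  have h := partb_step hJ hQ βu hβ Finset.univ ∅ (fun v hv => absurd hv (by simp))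
    (fun v hv => absurd hv (by simp))
  have e1 : colonOf F J ∅ ⊔ LC F Finset.univ = J ⊔ lastIdeal F := by
    refine IsMI.ext ((colon_MI hJ ∅).sup (LC_MI Finset.univ)) ((hJ.sup last_MI).congr fun w => ?_)
    simp [uA]
  rw [e1] at h
  convert h using 1
  funext k a
  unfold βT
  rw [← Finset.sum_fiberwise_of_maps_to (s := csfC m Finset.univ) (t := Finset.range (d + 1))
    (g := fun A => A.card)]
  · apply Finset.sum_congr rfl
    intro j _
    apply Finset.sum_congr
    · ext A
      simp [mem_csfC]
    · intro A hA
      rw [Finset.mem_filter] at hA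
      rw [hA.2, Finset.empty_union]
  · intro A hA
    have := CSF_card (mem_csfC.1 hA).1
    simp; omega

end p4

section p5

def rk {V : Type} [Fintype V] (v : V) : ℕ := Fintype.equivFin V v

lemma rk_inj {V : Type} [Fintype V] {v w : V} (h : rk v = rk w) : v = w :=
  (Fintype.equivFin V).injective (Fin.ext h)

/-- Koszul sign. -/
def sg {V : Type} [Fintype V] (A : Type*) [CommRing A] (B : Finset V) (v : V) : A :=
  (-1) ^ (B.filter (fun w => rk w < rk v)).card

lemma sg_insert {V : Type} [Fintype V] [DecidableEq V] (A : Type*) [CommRing A] {B : Finset V} {a : V} (b : V)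
    (h : a ∉ B) : sg A (insert a B) b = sg A B b * (if rk a < rk b then -1 else 1) := by
  unfold sg
  rw [Finset.filter_insert]
  split_ifs with h1
  · rw [Finset.card_insert_of_notMem, pow_succ]
    intro h2
    exact h (Finset.mem_filter.1 h2).1
  · rw [mul_one]

lemma sg_sq {V : Type} [Fintype V] [DecidableEq V] (A : Type*) [CommRing A] (B : Finset V) (a : V) :
    sg A B a * sg A B a = 1 := by
  unfold sg
  rw [← pow_add, ← two_mul]
  simp

lemma sg_anti {V : Type} [Fintype V] [DecidableEq V] (A : Type*) [CommRing A] {B : Finset V} {a b : V}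
    (ha : a ∉ B) (hb : b ∉ B) (hab : a ≠ b) :
    sg A B a * sg A (insert a B) b = -(sg A B b * sg A (insert b B) a) := by
  rw [sg_insert A b ha, sg_insert A a hb]
  have : rk a ≠ rk b := fun h => hab (rk_inj h)
  rcases lt_or_gt_of_ne this with h | h
  · rw [if_pos h, if_neg h.not_gt]; ring
  · rw [if_neg h.not_gt, if_pos h]; ring

lemma sg_anti' {V : Type} [Fintype V] [DecidableEq V] (A : Type*) [CommRing A] {B : Finset V} {a b : V}
    (ha : a ∉ B) (hb : b ∉ B) (hab : a ≠ b) :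
    sg A (insert a B) b * sg A (insert b B) a = -(sg A B a * sg A B b) := by
  rw [sg_insert A b ha, sg_insert A a hb]
  have : rk a ≠ rk b := fun h => hab (rk_inj h)
  rcases lt_or_gt_of_ne this with h | h
  · rw [if_pos h, if_neg h.not_gt]; ring
  · rw [if_neg h.not_gt, if_pos h]; ring

/-- Koszul type differential. -/
def Dk {V : Type} [Fintype V] [DecidableEq V] {A : Type*} [CommRing A] (t : V → A) (c : Finset V → A)
    (B : Finset V) : A :=
  ∑ v ∈ Finset.univ.filter (fun v => v ∉ B), sg A B v * t v * c (insert v B)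

lemma Dk_Dk {V : Type} [Fintype V] [DecidableEq V] {A : Type*} [CommRing A] (t : V → A) (c : Finset V → A)
    (B : Finset V) : Dk t (Dk t c) B = 0 := by
  unfold Dk
  simp only [Finset.mul_sum]
  rw [Finset.sum_sigma']
  apply Finset.sum_involution (fun p _ => ⟨p.2, p.1⟩)
  · rintro ⟨v, w⟩ h
    simp only [Finset.mem_sigma, Finset.mem_filter, Finset.mem_univ, true_and,
      Finset.mem_insert, not_or] at h
    obtain ⟨hv, hwv, hw⟩ := h
    simp only
    rw [Finset.insert_comm w v B]
    have := sg_anti A hv hw (Ne.symm hwv)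
    linear_combination (t v * t w * c (insert v (insert w B))) * this
  · rintro ⟨v, w⟩ h _ h'
    simp only [Finset.mem_sigma, Finset.mem_filter, Finset.mem_univ, true_and,
      Finset.mem_insert, not_or] at h
    simp only [Sigma.mk.injEq] at h'
    exact h.2.1 h'.1
  · rintro ⟨v, w⟩ h
    rfl
  · rintro ⟨v, w⟩ h
    simp only [Finset.mem_sigma, Finset.mem_filter, Finset.mem_univ, true_and,
      Finset.mem_insert, not_or] at h ⊢
    exact ⟨h.2.2, Ne.symm h.2.1, h.1⟩

def hk {V : Type} [Fintype V] [DecidableEq V] {A : Type*} [CommRing A] (v0 : V) (c : Finset V → A)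
    (B : Finset V) : A :=
  if v0 ∈ B then sg A (B.erase v0) v0 * c (B.erase v0) else 0

lemma hk_homotopy {V : Type} [Fintype V] [DecidableEq V] {A : Type*} [CommRing A] (v0 : V) (c : Finset V → A)
    (B : Finset V) : Dk (fun _ => 1) (hk v0 c) B + hk v0 (Dk (fun _ => 1) c) B = c B := by
  by_cases h : v0 ∈ B
  · obtain ⟨B', hB', rfl⟩ : ∃ B', v0 ∉ B' ∧ insert v0 B' = B :=
      ⟨B.erase v0, by simp, Finset.insert_erase h⟩
    unfold hk
    rw [if_pos h, Finset.erase_insert hB']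
    unfold Dk
    have e1 : Finset.univ.filter (fun v => v ∉ B') =
        insert v0 (Finset.univ.filter (fun v => v ∉ insert v0 B')) := by
      ext v
      by_cases hv : v = v0
      · subst hv; simp [hB']
      · simp [hv]
    rw [e1, Finset.sum_insert (by simp), mul_add, add_left_comm, Finset.mul_sum,
      ← Finset.sum_add_distrib, Finset.sum_eq_zero, add_zero]
    · rw [mul_one, ← mul_assoc, sg_sq, one_mul]
    · intro v hv
      simp only [Finset.mem_filter, Finset.mem_univ, true_and, Finset.mem_insert, not_or] at hv
      obtain ⟨hv0, hv⟩ := hv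
      have e2 : (insert v (insert v0 B')).erase v0 = insert v B' := by
        rw [Finset.insert_comm, Finset.erase_insert]
        simp [Ne.symm hv0, hB']
      simp only
      rw [if_pos (by simp), e2]
      have := sg_anti' A hB' hv (Ne.symm hv0)
      linear_combination c (insert v B') * this
  · unfold hk
    rw [if_neg h, add_zero]
    unfold Dk
    rw [Finset.sum_eq_single v0]
    · simp only
      rw [if_pos (by simp), Finset.erase_insert h, mul_one, ← mul_assoc, sg_sq, one_mul]
    · intro v hv hne
      simp only
      rw [if_neg, mul_zero]
      simp [h, Ne.symm hne]
    · intro h'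
      simp [h] at h'

variable {d : ℕ} {m : Fin d → ℕ} {F : Type*} [Field F]

def exk (k : ℕ) (x : CSFk d m k →₀ Pp d m F) (A : Finset (Var d m)) : Pp d m F :=
  if h : CSFSet A ∧ A.card = k then x ⟨A, h⟩ else 0

def tw (v : Var d m) : Pp d m F := MvPolynomial.monomial (sv v) 1

lemma exk_add (k : ℕ) (x y : CSFk d m k →₀ Pp d m F) (A) :
    exk k (x + y) A = exk k x A + exk k y A := by
  unfold exk; split_ifs <;> simp

lemma exk_smul (k : ℕ) (r : Pp d m F) (x : CSFk d m k →₀ Pp d m F) (A) :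
    exk k (r • x) A = r * exk k x A := by
  unfold exk; split_ifs <;> simp

lemma exk_val (k : ℕ) (x : CSFk d m k →₀ Pp d m F) (A : CSFk d m k) : exk k x A.1 = x A := by
  unfold exk; rw [dif_pos A.2]

lemma exk_ne {k : ℕ} {x : CSFk d m k →₀ Pp d m F} {A} (h : exk k x A ≠ 0) :
    CSFSet A ∧ A.card = k := by
  by_contra h'
  exact h (dif_neg h')

def rs (k : ℕ) (c : Finset (Var d m) → Pp d m F) : CSFk d m k →₀ Pp d m F :=
  Finsupp.equivFunOnFinite.symm (fun A => c A.1)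

lemma rs_apply (k : ℕ) (c : Finset (Var d m) → Pp d m F) (A) : rs k c A = c A.1 := rfl

lemma exk_rs (k : ℕ) (c : Finset (Var d m) → Pp d m F)
    (hc : ∀ A, c A ≠ 0 → CSFSet A ∧ A.card = k) : exk k (rs k c) = c := by
  funext A
  unfold exk
  split_ifs with h
  · rfl
  · by_contra h'
    exact h (hc A (Ne.symm h'))

lemma CSF_sub {A B : Finset (Var d m)} (h : CSFSet A) (hs : B ⊆ A) : CSFSet B :=
  fun v hv w hw => h v (hs hv) w (hs hw)

def ft (k : ℕ) : (CSFk d m (k + 1) →₀ Pp d m F) →ₗ[Pp d m F] (CSFk d m k →₀ Pp d m F) where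
  toFun x := rs k (Dk tw (exk (k + 1) x))
  map_add' x y := by
    ext1 B
    simp only [rs_apply, Finsupp.add_apply, Dk, exk_add, mul_add, Finset.sum_add_distrib]
  map_smul' r x := by
    ext1 B
    simp only [rs_apply, Finsupp.smul_apply, Dk, exk_smul, smul_eq_mul, RingHom.id_apply,
      Finset.mul_sum]
    exact Finset.sum_congr rfl fun v _ => by ring

lemma ft_apply (k : ℕ) (x : CSFk d m (k + 1) →₀ Pp d m F) (B) :
    ft k x B = Dk tw (exk (k + 1) x) B.1 := rfl

lemma exk_ft (k : ℕ) (x : CSFk d m (k + 1) →₀ Pp d m F) :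
    exk k (ft k x) = Dk tw (exk (k + 1) x) := by
  apply exk_rs
  intro B hB
  obtain ⟨v, hv, hne⟩ := Finset.exists_ne_zero_of_sum_ne_zero hB
  have hv : v ∉ B := by simpa using hv
  obtain ⟨h1, h2⟩ := exk_ne (right_ne_zero_of_mul hne)
  rw [Finset.card_insert_of_notMem hv] at h2
  exact ⟨CSF_sub h1 (Finset.subset_insert _ _), by omega⟩

lemma ft_ft (k : ℕ) (x : CSFk d m (k + 2) →₀ Pp d m F) : ft k (ft (k + 1) x) = 0 := by
  ext1 B
  rw [ft_apply, exk_ft, Dk_Dk]; rfl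

lemma coeff_sg_mul {σ V : Type} [Fintype V] [DecidableEq V] (B : Finset V) (v : V) (p : MvPolynomial σ F) (w) :
    MvPolynomial.coeff w (sg (MvPolynomial σ F) B v * p) = sg F B v * MvPolynomial.coeff w p := by
  have : sg (MvPolynomial σ F) B v = MvPolynomial.C (sg F B v) := by
    unfold sg; simp
  rw [this, MvPolynomial.coeff_C_mul]

lemma ft_Gr (k : ℕ) : Gr (F := F) (fun A : CSFk d m (k + 1) => shiftDeg A.1)
    (fun A : CSFk d m k => shiftDeg A.1) (ft k) := by
  intro A B μ hμ
  rw [ft_apply, Dk, MvPolynomial.coeff_sum] at hμ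
  obtain ⟨v, hv, hne⟩ := Finset.exists_ne_zero_of_sum_ne_zero hμ
  have hv : v ∉ B.1 := by simpa using hv
  rw [mul_assoc, coeff_sg_mul] at hne
  have hne := right_ne_zero_of_mul hne
  have h0 : exk (k + 1) (Finsupp.single A (1 : Pp d m F)) (insert v B.1) ≠ 0 := by
    intro h; rw [h] at hne; simp at hne
  have h1 := exk_ne h0
  have h2 : A = ⟨insert v B.1, h1⟩ := by
    by_contra hc
    apply h0
    unfold exk
    rw [dif_pos h1, Finsupp.single_apply, if_neg hc]
  have h3 : exk (k + 1) (Finsupp.single A (1 : Pp d m F)) (insert v B.1) = 1 := by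
    unfold exk
    rw [dif_pos h1, Finsupp.single_apply, if_pos h2]
  rw [h3, mul_one, tw, MvPolynomial.coeff_monomial] at hne
  have h4 : sv v = μ := by
    by_contra hc
    rw [if_neg hc] at hne
    exact hne rfl
  rw [h2, ← h4]
  simp only
  rw [shift_insert hv]

def inN (J : Ideal (Pp d m F)) (k : ℕ) (x : CSFk d m k →₀ Pp d m F) : Prop :=
  ∀ A, x A ∈ colonOf F J A.1

lemma shift_emb (A : Finset (Var d m)) (v) : shiftDeg A (emb v) = uA A (emb v) := by
  unfold shiftDeg uA
  rw [Finset.sum_add_distrib, Finsupp.add_apply, add_eq_left, Finsupp.finsetSum_apply]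
  apply Finset.sum_eq_zero
  intro w _
  rw [Finsupp.single_apply, if_neg]
  exact (emb_ne_last v w.1).symm

lemma Good.iff {Q : (Vtx d m →₀ ℕ) → Prop} (hQ : Good Q) {w w' : Vtx d m →₀ ℕ}
    (h : ∀ v, w (emb v) = w' (emb v)) : Q w ↔ Q w' :=
  ⟨hQ.mono _ _ fun v => (h v).le, hQ.mono _ _ fun v => (h v).ge⟩

lemma inN_of_Q {J : Ideal (Pp d m F)} {Q} (hJ : IsMI J Q) (hQ : Good Q) {k : ℕ}
    {x : CSFk d m k →₀ Pp d m F} {W} (hx : Hg (fun A : CSFk d m k => shiftDeg A.1) W x)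
    (hW : Q W) : inN J k x := by
  intro A
  rw [colon_MI hJ]
  intro w hw
  have h1 := hx A w hw
  refine (hQ.iff fun v => ?_).1 hW
  rw [← h1]
  simp [shift_emb]

lemma zero_of_inN {J : Ideal (Pp d m F)} {Q} (hJ : IsMI J Q) (hQ : Good Q) {k : ℕ}
    {x : CSFk d m k →₀ Pp d m F} {W} (hx : Hg (fun A : CSFk d m k => shiftDeg A.1) W x)
    (hW : ¬ Q W) (hN : inN J k x) : x = 0 := by
  ext A w
  by_contra hw
  have hw : MvPolynomial.coeff w (x A) ≠ 0 := by simpa using hw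
  have h1 := hx A w hw
  apply hW
  refine (hQ.iff fun v => ?_).1 ((colon_MI hJ A.1 _).1 (hN A) w hw)
  rw [← h1]
  simp [shift_emb]

lemma hc_mem {σ X : Type} {J : Ideal (MvPolynomial σ F)} {Q} (hJ : IsMI J Q) (dg : X → σ →₀ ℕ) (b)
    (x : X →₀ MvPolynomial σ F) (i : X) (h : x i ∈ J) : hc dg b x i ∈ J := by
  rw [hc_apply]
  split_ifs
  · rw [hJ]
    intro w hw
    rw [MvPolynomial.coeff_monomial] at hw
    split_ifs at hw with h1
    · exact (hJ _).1 h w (h1 ▸ hw)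
    · exact absurd rfl hw
  · exact J.zero_mem

lemma inN_hc {J : Ideal (Pp d m F)} {Q} (hJ : IsMI J Q) {k : ℕ}
    {x : CSFk d m k →₀ Pp d m F} (b) (hN : inN J k x) :
    inN J k (hc (fun A : CSFk d m k => shiftDeg A.1) b x) :=
  fun A => hc_mem (colon_MI hJ A.1) _ _ _ _ (hN A)

lemma inN_ft {J : Ideal (Pp d m F)} {Q} (hJ : IsMI J Q) (hQ : Good Q) {k : ℕ}
    {x : CSFk d m (k + 1) →₀ Pp d m F} (hN : inN J (k + 1) x) : inN J k (ft k x) := by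
  intro B
  rw [ft_apply]
  apply Ideal.sum_mem
  intro v hv
  have hv : v ∉ B.1 := by simpa using hv
  rw [mul_assoc]
  apply Ideal.mul_mem_left
  by_cases h : exk (k + 1) x (insert v B.1) = 0
  · rw [h, mul_zero]; exact Ideal.zero_mem _
  · have h1 := exk_ne h
    have h2 : exk (k + 1) x (insert v B.1) = x ⟨_, h1⟩ := dif_pos h1
    rw [h2, mul_comm, tw, MI_mul_mono (colon_MI hJ _)]
    intro w hw
    refine hQ.mono _ _ (fun u => ?_) ((colon_MI hJ _ _).1 (hN ⟨_, h1⟩) w hw)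
    simp only [uA_insert hv, Finsupp.add_apply, sv]
    omega

def mkW (W : Vtx d m →₀ ℕ) (γ : Finset (Var d m) → F) (A : Finset (Var d m)) : Pp d m F :=
  MvPolynomial.monomial (W - shiftDeg A) (γ A)

lemma Dk_mkW (W : Vtx d m →₀ ℕ) (γ : Finset (Var d m) → F) (hγ : ∀ A, γ A ≠ 0 → shiftDeg A ≤ W) :
    Dk tw (mkW W γ) = mkW W (Dk (fun _ => 1) γ) := by
  funext B
  unfold Dk mkW
  rw [map_sum]
  apply Finset.sum_congr rfl
  intro v hv
  have hv : v ∉ B := by simpa using hv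
  have hs : sg (Pp d m F) B v = MvPolynomial.C (sg F B v) := by
    unfold sg; simp
  by_cases h : γ (insert v B) = 0
  · simp [h]
  · have h1 := hγ _ h
    rw [shift_insert hv] at h1 ⊢
    rw [hs, tw, mul_assoc, MvPolynomial.monomial_mul, MvPolynomial.C_mul_monomial, mul_one, one_mul]
    congr 1
    rw [add_comm (sv v) (shiftDeg B), ← tsub_tsub,
      add_tsub_cancel_of_le (le_tsub_of_add_le_right h1)]

lemma shift_le {A : Finset (Var d m)} {W : Vtx d m →₀ ℕ} (hA : CSFSet A) (h : ∀ v ∈ A, sv v ≤ W) :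
    shiftDeg A ≤ W := by
  intro z
  have e : shiftDeg A z = ∑ v ∈ A, sv v z := by
    unfold shiftDeg
    rw [Finsupp.finsetSum_apply]; rfl
  rw [e]
  by_cases hz : ∃ v ∈ A, sv v z ≠ 0
  · obtain ⟨v, hv, hvz⟩ := hz
    rw [Finset.sum_eq_single v]
    · exact h v hv z
    · intro w hw hwv
      by_contra hne
      apply hwv
      apply hA w hw v hv
      have key : ∀ u : Var d m, sv u z ≠ 0 → z.1 = u.1 := by
        intro u hu
        by_contra hc
        apply hu
        have h1 : emb u ≠ z := by rintro rfl; exact hc rfl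
        have h2 : yv u ≠ z := by rintro rfl; exact hc rfl
        rw [sv, Finsupp.add_apply, Finsupp.single_apply, Finsupp.single_apply, if_neg h1,
          if_neg h2, add_zero]
      rw [← key w hne, ← key v hvz]
    · intro h'; exact absurd hv h'
  · push Not at hz
    rw [Finset.sum_eq_zero hz]
    exact Nat.zero_le _

lemma sv_le_shift {A : Finset (Var d m)} {v : Var d m} (hv : v ∈ A) : sv v ≤ shiftDeg A := by
  rw [← Finset.insert_erase hv, shift_insert (by simp)]
  exact le_self_add

lemma exact_core {Q : (Vtx d m →₀ ℕ) → Prop} (hQ : Good Q) {W : Vtx d m →₀ ℕ} (hW : ¬ Q W)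
    {k : ℕ} {γ : Finset (Var d m) → F}
    (hγ : ∀ A, γ A ≠ 0 → (CSFSet A ∧ A.card = k) ∧ shiftDeg A ≤ W)
    (hd : Dk (fun _ => 1) γ = 0) (v0 : Var d m) (hv0 : sv v0 ≤ W) :
    ∃ y, ft k y = rs k (mkW W γ) := by
  have hT : ∀ v w : Var d m, sv v ≤ W → sv w ≤ W → v.1 = w.1 → v = w := by
    intro v w hv hw hvw
    by_contra hne
    exact hW (hQ.br W v w hvw hne ((sv_le _ _).1 hv).1 ((sv_le _ _).1 hw).1)
  have hh : ∀ A, hk v0 γ A ≠ 0 → (CSFSet A ∧ A.card = k + 1) ∧ shiftDeg A ≤ W := by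
    intro A hA
    unfold hk at hA
    split_ifs at hA with h0
    · obtain ⟨⟨h1, h2⟩, h3⟩ := hγ _ (right_ne_zero_of_mul hA)
      have h4 : ∀ v ∈ A, sv v ≤ W := by
        intro v hv
        by_cases h : v = v0
        · rw [h]; exact hv0
        · exact (sv_le_shift (Finset.mem_erase.2 ⟨h, hv⟩)).trans h3
      have h5 : CSFSet A := fun v hv w hw => hT v w (h4 v hv) (h4 w hw)
      refine ⟨⟨h5, ?_⟩, shift_le h5 h4⟩
      rw [← h2, Finset.card_erase_add_one h0]
    · exact absurd rfl hA
  refine ⟨rs (k + 1) (mkW W (hk v0 γ)), ?_⟩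
  ext1 B
  rw [ft_apply, exk_rs, Dk_mkW]
  · rw [rs_apply, mkW, mkW]
    congr 1
    have h1 := hk_homotopy v0 γ B.1
    rw [hd] at h1
    rw [← h1, left_eq_add]
    unfold hk
    split_ifs <;> simp
  · exact fun A hA => (hh A hA).2
  · intro A hA
    refine (hh A fun h => hA ?_).1
    rw [mkW, h, map_zero]

lemma homog_rep {k : ℕ} {x : CSFk d m k →₀ Pp d m F} {W : Vtx d m →₀ ℕ}
    (hx : Hg (fun A : CSFk d m k => shiftDeg A.1) W x) :
    ∃ γ : Finset (Var d m) → F, exk k x = mkW W γ ∧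
      ∀ A, γ A ≠ 0 → (CSFSet A ∧ A.card = k) ∧ shiftDeg A ≤ W := by
  have key : ∀ A μ, MvPolynomial.coeff μ (exk k x A) ≠ 0 → μ + shiftDeg A = W := by
    intro A μ h
    have h1 : CSFSet A ∧ A.card = k := exk_ne (fun h' => h (by rw [h']; simp))
    have h2 : exk k x A = x ⟨A, h1⟩ := dif_pos h1
    rw [h2] at h
    exact hx _ _ h
  refine ⟨fun A => MvPolynomial.coeff (W - shiftDeg A) (exk k x A), ?_, ?_⟩
  · funext A
    ext μ
    rw [mkW, MvPolynomial.coeff_monomial]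
    split_ifs with h
    · rw [h]
    · by_contra h'
      apply h
      rw [← key A μ h']
      simp
  · intro A hA
    refine ⟨exk_ne (x := x) (fun h' => hA (by simp [h'])), ?_⟩
    rw [← key A _ hA]
    exact le_add_self

lemma rs_exk (k : ℕ) (x : CSFk d m k →₀ Pp d m F) : rs k (exk k x) = x := by
  ext1 A
  rw [rs_apply, exk_val]

lemma inN_zero (J : Ideal (Pp d m F)) (k : ℕ) : inN J k 0 := fun A => Ideal.zero_mem _

lemma mkW_zero {W : Vtx d m →₀ ℕ} {γ : Finset (Var d m) → F} (h : mkW W γ = 0) : γ = 0 := by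
  funext A
  have := congrFun h A
  rw [mkW, Pi.zero_apply, MvPolynomial.monomial_eq_zero] at this
  exact this

lemma exact_hom {J : Ideal (Pp d m F)} {Q} (hJ : IsMI J Q) (hQ : Good Q) {k : ℕ}
    {x : CSFk d m (k + 1) →₀ Pp d m F} {W}
    (hx : Hg (fun A : CSFk d m (k + 1) => shiftDeg A.1) W x) (hN : inN J k (ft k x)) :
    ∃ y, inN J (k + 1) (x - ft (k + 1) y) := by
  by_cases hW : Q W
  · exact ⟨0, by simpa using inN_of_Q hJ hQ hx hW⟩
  have h0 : ft k x = 0 := zero_of_inN hJ hQ ((ft_Gr k).map hx) hW hN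
  obtain ⟨γ, h1, h2⟩ := homog_rep hx
  by_cases hγ : γ = 0
  · refine ⟨0, ?_⟩
    have : x = 0 := by
      rw [← rs_exk _ x, h1, hγ]
      ext1 A
      simp [rs_apply, mkW]
    rw [this]
    simpa using inN_zero J _
  obtain ⟨A, hA⟩ := Function.ne_iff.1 hγ
  obtain ⟨⟨h3, h4⟩, h5⟩ := h2 A hA
  obtain ⟨v0, hv0⟩ := Finset.card_pos.1 (show 0 < A.card by omega)
  have hd : Dk (fun _ => 1) γ = 0 := by
    apply mkW_zero (W := W)
    rw [← Dk_mkW W γ (fun A hA => (h2 A hA).2), ← h1, ← exk_ft, h0]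
    funext A
    unfold exk
    split_ifs <;> rfl
  obtain ⟨y, hy⟩ := exact_core hQ hW h2 hd v0 ((sv_le_shift hv0).trans h5)
  refine ⟨y, ?_⟩
  rw [hy, ← h1, rs_exk, sub_self]
  exact inN_zero J _

def e0 : CSFk d m 0 := ⟨∅, fun v hv => absurd hv (by simp), rfl⟩

lemma e0_eq (A : CSFk d m 0) : A = e0 := by
  apply Subtype.ext
  exact Finset.card_eq_zero.1 A.2.2

lemma exact_hom0 {J : Ideal (Pp d m F)} {Q} (hJ : IsMI J Q) (hQ : Good Q)
    {x : CSFk d m 0 →₀ Pp d m F} {W}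
    (hx : Hg (fun A : CSFk d m 0 => shiftDeg A.1) W x) (hN : x e0 ∈ J ⊔ lastIdeal F) :
    ∃ y, inN J 0 (x - ft 0 y) := by
  by_cases hW : Q W
  · exact ⟨0, by simpa using inN_of_Q hJ hQ hx hW⟩
  obtain ⟨γ, h1, h2⟩ := homog_rep hx
  by_cases hγ : γ ∅ = 0
  · refine ⟨0, ?_⟩
    have : x = 0 := by
      ext1 A
      rw [e0_eq A, ← exk_val, h1]
      simp [e0, mkW, hγ]
    rw [this]
    simpa using inN_zero J _
  have h3 : x e0 = MvPolynomial.monomial W (γ ∅) := by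
    rw [← exk_val, h1]
    simp [e0, mkW, shiftDeg]
  have h4 := ((hJ.sup last_MI) _).1 hN W (by rw [h3]; simpa using hγ)
  obtain ⟨v0, hv0⟩ := h4.resolve_left hW
  have hd : Dk (fun _ => 1) γ = 0 := by
    funext B
    apply Finset.sum_eq_zero
    intro v hv
    have : γ (insert v B) = 0 := by
      by_contra h
      have := (h2 _ h).1.2
      simp at this
    rw [this, mul_zero]
  obtain ⟨y, hy⟩ := exact_core hQ hW h2 hd v0 hv0
  refine ⟨y, ?_⟩
  rw [hy, ← h1, rs_exk, sub_self]
  exact inN_zero J _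

lemma glue {J : Ideal (Pp d m F)} {k : ℕ} (x : CSFk d m k →₀ Pp d m F)
    (h : ∀ b, ∃ y, inN J k (hc (fun A : CSFk d m k => shiftDeg A.1) b x - ft k y)) :
    ∃ y, inN J k (x - ft k y) := by
  choose y hy using h
  obtain ⟨s, hs⟩ := sum_hc (fun A : CSFk d m k => shiftDeg A.1) x
  refine ⟨∑ b ∈ s, y b, ?_⟩
  have : x - ft k (∑ b ∈ s, y b) =
      ∑ b ∈ s, (hc (fun A : CSFk d m k => shiftDeg A.1) b x - ft k (y b)) := by
    rw [Finset.sum_sub_distrib, ← hs, map_sum]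
  rw [this]
  intro A
  rw [Finsupp.finsetSum_apply]
  exact Ideal.sum_mem _ fun b _ => hy b A

lemma exact_ft {J : Ideal (Pp d m F)} {Q} (hJ : IsMI J Q) (hQ : Good Q) {k : ℕ}
    {x : CSFk d m (k + 1) →₀ Pp d m F} (hN : inN J k (ft k x)) :
    ∃ y, inN J (k + 1) (x - ft (k + 1) y) := by
  apply glue
  intro b
  apply exact_hom hJ hQ (Hg_hc _ b x)
  rw [← hc_map (ft_Gr k)]
  exact inN_hc hJ b hN

lemma exact_ft0 {J : Ideal (Pp d m F)} {Q} (hJ : IsMI J Q) (hQ : Good Q)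
    {x : CSFk d m 0 →₀ Pp d m F} (hN : x e0 ∈ J ⊔ lastIdeal F) :
    ∃ y, inN J 0 (x - ft 0 y) := by
  apply glue
  intro b
  apply exact_hom0 hJ hQ (Hg_hc _ b x)
  exact hc_mem (hJ.sup last_MI) _ _ _ _ hN

lemma descend {R A B C : Type*} [CommRing R] [AddCommGroup A] [AddCommGroup B] [AddCommGroup C]
    [Module R A] [Module R B] [Module R C] (π : A →ₗ[R] B) (hπ : Function.Surjective π)
    (φ : A →ₗ[R] C) (h : ∀ x, π x = 0 → φ x = 0) : ∃ f : B →ₗ[R] C, ∀ x, f (π x) = φ x := by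
  refine ⟨(LinearMap.ker π).liftQ φ (fun x hx => h x hx) ∘ₗ
    (π.quotKerEquivOfSurjective hπ).symm.toLinearMap, fun x => ?_⟩
  have : (π.quotKerEquivOfSurjective hπ).symm (π x) = Submodule.Quotient.mk x := by
    rw [LinearEquiv.symm_apply_eq]; rfl
  simp only [LinearMap.comp_apply, LinearEquiv.coe_coe, this]
  exact Submodule.liftQ_apply _ _ _

def pik (J : Ideal (Pp d m F)) (k : ℕ) : (CSFk d m k →₀ Pp d m F) →ₗ[Pp d m F] FmodC F J k where
  toFun x A := Submodule.Quotient.mk (x A)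
  map_add' x y := by funext A; rfl
  map_smul' r x := by funext A; rfl

lemma pik_apply (J : Ideal (Pp d m F)) (k : ℕ) (x A) :
    pik J k x A = Submodule.Quotient.mk (x A) := rfl

lemma pik_zero {J : Ideal (Pp d m F)} {k : ℕ} {x} : pik J k x = 0 ↔ inN J k x := by
  constructor
  · intro h A
    have := congrFun h A
    rw [pik_apply] at this
    exact (Submodule.Quotient.mk_eq_zero _).1 this
  · intro h
    funext A
    rw [pik_apply]
    exact (Submodule.Quotient.mk_eq_zero _).2 (h A)

lemma pik_surj (J : Ideal (Pp d m F)) (k : ℕ) : Function.Surjective (pik J k) := by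
  intro z
  choose x hx using fun A => Submodule.Quotient.mk_surjective _ (z A)
  refine ⟨Finsupp.equivFunOnFinite.symm x, ?_⟩
  funext A
  rw [pik_apply]
  exact hx A

lemma pik_single (J : Ideal (Pp d m F)) (k : ℕ) (A : CSFk d m k) (p : Pp d m F) :
    Pi.single (M := fun B : CSFk d m k => Pp d m F ⧸ colonOf F J B.1) A
      (Submodule.Quotient.mk p) = pik J k (p • Finsupp.single A 1) := by
  funext B
  rw [pik_apply]
  by_cases h : B = A
  · subst h; simp
  · rw [Pi.single_eq_of_ne h]
    simp [Finsupp.single_apply, Ne.symm h]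

theorem parta {J : Ideal (Pp d m F)} {Q} (hJ : IsMI J Q) (hQ : Good Q) :
    (∃ (f : ∀ k : ℕ, FmodC F J (k + 1) →ₗ[Pp d m F] FmodC F J k)
      (g : FmodC F J 0 →ₗ[Pp d m F] Pp d m F ⧸ (J ⊔ lastIdeal F)),
      Function.Surjective g ∧
      (∀ A : CSFk d m 0,
        GradedBetween F (colonOf F J A.1) (J ⊔ lastIdeal F)
          (shiftDeg A.1) 0
          (g ∘ₗ LinearMap.single (Pp d m F)
            (fun B : CSFk d m 0 => Pp d m F ⧸ colonOf F J B.1) A)) ∧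
      (∀ (k : ℕ) (A : CSFk d m (k + 1)) (B : CSFk d m k),
        GradedBetween F (colonOf F J A.1) (colonOf F J B.1)
          (shiftDeg A.1) (shiftDeg B.1) (piComp (f k) A B)) ∧
      (LinearMap.ker g = LinearMap.range (f 0)) ∧
      (∀ k : ℕ, LinearMap.ker (f k) = LinearMap.range (f (k + 1)))) := by
  have hf := fun k => descend (pik J (k + 1)) (pik_surj J (k + 1)) (pik J k ∘ₗ ft k) (fun x hx => by
    rw [LinearMap.comp_apply, pik_zero]
    exact inN_ft hJ hQ (pik_zero.1 hx))
  choose f hf using hf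
  simp only [LinearMap.comp_apply] at hf
  obtain ⟨g, hg⟩ := descend (pik J 0) (pik_surj J 0)
    ((Submodule.mkQ (J ⊔ lastIdeal F)) ∘ₗ Finsupp.lapply e0) (fun x hx => by
      have h1 := pik_zero.1 hx e0
      have h2 : x e0 ∈ J := by
        rw [hJ]
        intro w hw
        simpa [e0, uA] using (colon_MI hJ _ _).1 h1 w hw
      exact (Submodule.Quotient.mk_eq_zero _).2 (Ideal.mem_sup_left h2))
  have hg' : ∀ x, g (pik J 0 x) = Submodule.Quotient.mk (x e0) := hg
  refine ⟨f, g, ?_, ?_, ?_, ?_, ?_⟩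
  · intro z
    obtain ⟨p, rfl⟩ := Submodule.Quotient.mk_surjective _ z
    refine ⟨pik J 0 (Finsupp.single e0 p), ?_⟩
    rw [hg']; simp
  · intro A
    rw [e0_eq A]
    refine ⟨1, ?_, ?_⟩
    · intro μ hμ
      rw [MvPolynomial.coeff_one] at hμ
      have : 0 = μ := by
        by_contra h; rw [if_neg h] at hμ; exact hμ rfl
      rw [← this]
      simp [e0, shiftDeg]
    · intro x
      rw [LinearMap.comp_apply, LinearMap.single_apply, pik_single, hg']
      simp
  · intro k A B
    refine ⟨ft k (Finsupp.single A 1) B, fun μ hμ => ft_Gr k A B μ hμ, fun x => ?_⟩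
    rw [piComp, LinearMap.comp_apply, LinearMap.comp_apply, LinearMap.single_apply, pik_single, hf,
      map_smul, LinearMap.proj_apply, pik_apply, Finsupp.smul_apply, smul_eq_mul, mul_comm]
  · ext z
    obtain ⟨x, rfl⟩ := pik_surj J 0 z
    rw [LinearMap.mem_ker, hg', Submodule.Quotient.mk_eq_zero]
    constructor
    · intro h
      obtain ⟨y, hy⟩ := exact_ft0 hJ hQ h
      refine ⟨pik J 1 y, ?_⟩
      rw [hf, eq_comm, ← sub_eq_zero, ← map_sub, pik_zero]
      exact hy
    · rintro ⟨z, hz⟩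
      obtain ⟨y, rfl⟩ := pik_surj J 1 z
      rw [hf] at hz
      have hm : ft 0 y e0 ∈ J ⊔ lastIdeal F := by
        rw [ft_apply]
        apply Ideal.sum_mem
        intro v _
        apply Ideal.mul_mem_right
        apply Ideal.mul_mem_left
        exact Ideal.mem_sup_right (last_MI.monomial ⟨v, le_refl _⟩ 1)
      have := congrArg g hz
      rw [hg', hg', (Submodule.Quotient.mk_eq_zero _).2 hm] at this
      exact (Submodule.Quotient.mk_eq_zero _).1 this.symm
  · intro k
    ext z
    obtain ⟨x, rfl⟩ := pik_surj J (k + 1) z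
    rw [LinearMap.mem_ker, hf, pik_zero]
    constructor
    · intro h
      obtain ⟨y, hy⟩ := exact_ft hJ hQ h
      refine ⟨pik J (k + 2) y, ?_⟩
      rw [hf, eq_comm, ← sub_eq_zero, ← map_sub, pik_zero]
      exact hy
    · rintro ⟨z, hz⟩
      obtain ⟨y, rfl⟩ := pik_surj J (k + 2) z
      have := congrArg (f k) hz
      rw [hf, hf, ft_ft, map_zero, hf] at this
      exact pik_zero.1 this.symm

end p5

/-- Theorem `thm:add polarized squares` (a), (b).  Let `I ⊆ P(d,m)` be a
color-squarefree monomial ideal and `I' = I + 𝔪_1^{[2]} + ⋯ + 𝔪_d^{[2]} ⊆ P'`.  Then (a)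
there is an exact sequence of `ℤ^{d+|m|}`-graded `P'`-modules
`0 → G_d → ⋯ → G_1 → G_0 = P'/I' → P'/(I' + Σ_i x_{i,m_i+1}·𝔪_i) → 0` with
`G_k = ⊕_{u ∈ [Mon_cs(P)]_k} (P'/(I' : u))(-deg(u·∏_{i ∈ cSupp u} x_{i,m_i+1}))`; and (b)
`P'/(I' + Σ_i x_{i,m_i+1}·𝔪_i)` is minimally resolved by iterated mapping cones from this
sequence: assembling minimal multigraded free resolutions of the pieces `P'/(I' : u)` with
the corresponding degree shifts yields a minimal multigraded free resolution (there is no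
cancellation), so the Betti numbers add up. -/
theorem statement_17 {d : ℕ} {m : Fin d → ℕ} (K : Type*) [Field K]
    (I : Ideal (PR d m K))
    (hcsf : ∃ S : Set (Mon d m), (∀ u ∈ S, ColorSquarefree u) ∧
      I = Ideal.span (mon K '' S)) :
    (∃ (f : ∀ k : ℕ, FmodC K (extBr K I) (k + 1) →ₗ[Pp d m K] FmodC K (extBr K I) k)
      (g : FmodC K (extBr K I) 0 →ₗ[Pp d m K] Pp d m K ⧸ (extBr K I ⊔ lastIdeal K)),
      Function.Surjective g ∧
      (∀ A : CSFk d m 0,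
        GradedBetween K (colonOf K (extBr K I) A.1) (extBr K I ⊔ lastIdeal K)
          (shiftDeg A.1) 0
          (g ∘ₗ LinearMap.single (Pp d m K)
            (fun B : CSFk d m 0 => Pp d m K ⧸ colonOf K (extBr K I) B.1) A)) ∧
      (∀ (k : ℕ) (A : CSFk d m (k + 1)) (B : CSFk d m k),
        GradedBetween K (colonOf K (extBr K I) A.1) (colonOf K (extBr K I) B.1)
          (shiftDeg A.1) (shiftDeg B.1) (piComp (f k) A B)) ∧
      (LinearMap.ker g = LinearMap.range (f 0)) ∧
      (∀ k : ℕ, LinearMap.ker (f k) = LinearMap.range (f (k + 1)))) ∧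
    (∀ βu : Finset (Var d m) → ℕ → (Vtx d m →₀ ℕ) → ℕ,
      (∀ A : Finset (Var d m), CSFSet A →
        IsMinFreeRes (Vtx d m) K (id : (Vtx d m →₀ ℕ) → (Vtx d m →₀ ℕ))
          (colonOf K (extBr K I) A) (βu A)) →
      IsMinFreeRes (Vtx d m) K (id : (Vtx d m →₀ ℕ) → (Vtx d m →₀ ℕ))
        (extBr K I ⊔ lastIdeal K)
        (fun k a => ∑ j ∈ Finset.range (d + 1),
          ∑ A ∈ Finset.univ.filter
            (fun A : Finset (Var d m) => CSFSet A ∧ A.card = j),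
            if j ≤ k ∧ shiftDeg A ≤ a then βu A (k - j) (a - shiftDeg A) else 0)) := by
  obtain ⟨S, _, hS⟩ := hcsf
  obtain ⟨Q, hQ, hJ⟩ := ext_good S I hS
  exact ⟨parta hJ hQ, fun βu hβ => partb hJ hQ βu hβ⟩

end BalSq
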